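/- Let k be a positive integer. There is no D(-8k²)-quadruple {8k², 8k²+1, c, d} of positive integers with 1 < c < d. -/

import Mathlib

/-- Ladder of solutions of the Pell equation `t^2 - (x^2-1) u^2 = 1`. -/
def lad (x : ℤ) : ℕ → ℤ × ℤ
  | 0 => (1, 0)
  | n + 1 => (x * (lad x n).1 + (x ^ 2 - 1) * (lad x n).2, (lad x n).1 + x * (lad x n).2)

def lt (x : ℤ) (n : ℕ) : ℤ := (lad x n).1
def lu (x : ℤ) (n : ℕ) : ℤ := (lad x n).2

lemma lt_zero (x : ℤ) : lt x 0 = 1 := rfl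
lemma lu_zero (x : ℤ) : lu x 0 = 0 := rfl
lemma lt_succ (x : ℤ) (n : ℕ) : lt x (n + 1) = x * lt x n + (x ^ 2 - 1) * lu x n := rfl
lemma lu_succ (x : ℤ) (n : ℕ) : lu x (n + 1) = lt x n + x * lu x n := rfl
lemma lt_one (x : ℤ) : lt x 1 = x := by rw [lt_succ, lt_zero, lu_zero]; ring
lemma lu_one (x : ℤ) : lu x 1 = 1 := by rw [lu_succ, lt_zero, lu_zero]; ring

lemma lad_pell (x : ℤ) (n : ℕ) : lt x n ^ 2 = (x ^ 2 - 1) * lu x n ^ 2 + 1 := by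
  induction n with
  | zero => simp [lt_zero, lu_zero]
  | succ n ih => rw [lt_succ, lu_succ]; linear_combination ih

lemma lad_add (x : ℤ) (i j : ℕ) :
    lt x (i + j) = lt x i * lt x j + (x ^ 2 - 1) * lu x i * lu x j ∧
    lu x (i + j) = lt x i * lu x j + lu x i * lt x j := by
  induction j with
  | zero => simp [lt_zero, lu_zero]
  | succ n ih =>
    obtain ⟨h1, h2⟩ := ih
    rw [← add_assoc, lt_succ, lu_succ, lt_succ, lu_succ, h1, h2]
    constructor <;> ring

lemma lt_add (x : ℤ) (i j : ℕ) :
    lt x (i + j) = lt x i * lt x j + (x ^ 2 - 1) * lu x i * lu x j := (lad_add x i j).1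
lemma lu_add (x : ℤ) (i j : ℕ) :
    lu x (i + j) = lt x i * lu x j + lu x i * lt x j := (lad_add x i j).2

lemma lt_two_mul (x : ℤ) (l : ℕ) : lt x (2 * l) = 1 + 2 * (x ^ 2 - 1) * lu x l ^ 2 := by
  rw [two_mul, lt_add]; linear_combination lad_pell x l
lemma lu_two_mul (x : ℤ) (l : ℕ) : lu x (2 * l) = 2 * lt x l * lu x l := by
  rw [two_mul, lu_add]; ring

lemma lad_nonneg (x : ℤ) (hx : 1 ≤ x) (n : ℕ) : 1 ≤ lt x n ∧ 0 ≤ lu x n := by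
  induction n with
  | zero => simp [lt_zero, lu_zero]
  | succ n ih =>
    obtain ⟨h1, h2⟩ := ih
    rw [lt_succ, lu_succ]
    have : 0 ≤ x ^ 2 - 1 := by nlinarith
    constructor
    · have := mul_nonneg this h2
      nlinarith
    · nlinarith

lemma lt_ge_one (x : ℤ) (hx : 1 ≤ x) (n : ℕ) : 1 ≤ lt x n := (lad_nonneg x hx n).1
lemma lu_nonneg (x : ℤ) (hx : 1 ≤ x) (n : ℕ) : 0 ≤ lu x n := (lad_nonneg x hx n).2

lemma lu_lt_succ (x : ℤ) (hx : 1 ≤ x) (n : ℕ) : lu x n < lu x (n + 1) := by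
  rw [lu_succ]; nlinarith [lad_nonneg x hx n]
lemma lu_strictMono (x : ℤ) (hx : 1 ≤ x) : StrictMono (lu x) :=
  strictMono_nat_of_lt_succ (lu_lt_succ x hx)

lemma lu_pos (x : ℤ) (hx : 1 ≤ x) (n : ℕ) (hn : 1 ≤ n) : 1 ≤ lu x n := by
  have := lu_strictMono x hx (show 0 < n by omega)
  rw [lu_zero] at this; omega

/-- growth: `u_{n+1} ≥ (2x-1) u_n`. -/
lemma lu_growth (x : ℤ) (hx : 1 ≤ x) (n : ℕ) : (2 * x - 1) * lu x n ≤ lu x (n + 1) := by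
  rw [lu_succ]
  obtain ⟨h1, h2⟩ := lad_nonneg x hx n
  have hp := lad_pell x n
  have : (x - 1) * lu x n ≤ lt x n := by
    apply le_of_sq_le_sq _ (by omega)
    rw [hp]
    nlinarith [mul_nonneg (show (0:ℤ) ≤ x - 1 by omega) (sq_nonneg (lu x n))]
  nlinarith

/-- upper growth `u_{n+1} ≤ 2x u_n` for `n ≥ 1`. -/
lemma lu_growth_le (x : ℤ) (hx : 1 ≤ x) (n : ℕ) (hn : 1 ≤ n) : lu x (n + 1) ≤ 2 * x * lu x n := by
  rw [lu_succ]
  obtain ⟨h1, h2⟩ := lad_nonneg x hx n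
  have hu := lu_pos x hx n hn
  have hp := lad_pell x n
  have : lt x n ≤ x * lu x n := by
    apply le_of_sq_le_sq _ (by nlinarith)
    rw [hp]
    nlinarith
  nlinarith

lemma lu_ge_pow (x : ℤ) (hx : 1 ≤ x) (n : ℕ) : (2 * x - 1) ^ n ≤ lu x (n + 1) := by
  induction n with
  | zero => simp [lu_one]
  | succ n ih =>
    calc (2 * x - 1) ^ (n + 1) = (2 * x - 1) * (2 * x - 1) ^ n := by ring
      _ ≤ (2 * x - 1) * lu x (n + 1) := by
          apply mul_le_mul_of_nonneg_left ih; omega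
      _ ≤ _ := lu_growth x hx _

lemma lu_le_pow (x : ℤ) (hx : 1 ≤ x) (n : ℕ) : lu x (n + 1) ≤ (2 * x) ^ n := by
  induction n with
  | zero => simp [lu_one]
  | succ n ih =>
    calc lu x (n + 1 + 1) ≤ 2 * x * lu x (n + 1) := lu_growth_le x hx _ (by omega)
      _ ≤ 2 * x * (2 * x) ^ n := by
          apply mul_le_mul_of_nonneg_left ih; omega
      _ = _ := by ring

/-- mod (x-1): t ≡ 1, u_n ≡ n. -/
lemma lad_mod (x : ℤ) (n : ℕ) : (x - 1) ∣ lt x n - 1 ∧ (x - 1) ∣ lu x n - n := by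
  induction n with
  | zero => simp [lt_zero, lu_zero]
  | succ n ih =>
    obtain ⟨⟨p, hp⟩, ⟨q, hq⟩⟩ := ih
    rw [lt_succ, lu_succ]
    constructor
    · exact ⟨lt x n + p + (x + 1) * lu x n, by linear_combination hp⟩
    · refine ⟨p + q + lu x n, ?_⟩
      push_cast; linear_combination hp + hq

lemma lad_coprime (x : ℤ) (n : ℕ) : IsCoprime (lt x n) (lu x n) :=
  ⟨lt x n, -(x ^ 2 - 1) * lu x n, by linear_combination lad_pell x n⟩

/-- `n = B + A` version of reflection: `u_{B+A+A}`... -/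
lemma lu_reflect (x : ℤ) (A e : ℕ) :
    lu x (A + (A + e)) + lu x e = 2 * lu x (A + e) * lt x A := by
  rw [lu_add x A (A + e), lt_add x A e, lu_add x A e]
  linear_combination -(lu x e) * lad_pell x A

lemma lu_shift (x : ℤ) (B e : ℕ) :
    lu x (2 * B + e) - lu x e = 2 * lu x B * lt x (B + e) := by
  rw [two_mul, add_assoc, lu_add x B (B + e), lt_add x B e, lu_add x B e]
  linear_combination (lu x e) * lad_pell x B

/-- All solutions of `t^2 = (x^2-1) u^2+1` in positive integers are on the ladder, scaled version:
 `t^2 = E m^2 + 1` where `E g^2 = x^2-1` and no solutions with `0<m<g`. -/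
lemma lad_complete (x E g : ℤ) (hx : 1 < x) (hg : 0 < g) (hE : E * g ^ 2 = x ^ 2 - 1)
    (hno : ∀ t m : ℤ, 0 < m → m < g → t ^ 2 ≠ E * m ^ 2 + 1) :
    ∀ N : ℕ, ∀ t m : ℤ, 0 ≤ t → 0 ≤ m → m ≤ N → t ^ 2 = E * m ^ 2 + 1 →
      ∃ n : ℕ, t = lt x n ∧ m = g * lu x n := by
  intro N
  have hEpos : 0 < E := by
    by_contra h
    have : E * g ^ 2 ≤ 0 := mul_nonpos_of_nonpos_of_nonneg (by omega) (by positivity)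
    nlinarith
  induction N with
  | zero =>
    intro t m ht hm hmN h
    have : m = 0 := by push_cast at hmN; omega
    subst this
    refine ⟨0, ?_, by simp [lu_zero]⟩
    rw [lt_zero]; nlinarith
  | succ N ih =>
    intro t m ht hm hmN h
    rcases eq_or_lt_of_le hm with h0 | h0
    · subst h0
      refine ⟨0, ?_, by simp [lu_zero]⟩
      rw [lt_zero]; nlinarith
    have hgm : g ≤ m := by
      by_contra hc
      exact hno t m h0 (by omega) h
    -- t ≤ x m / g: t g ≤ x m
    have h1 : t * g ≤ x * m := by
      apply le_of_sq_le_sq _ (by positivity)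
      have : (t * g) ^ 2 = (x * m) ^ 2 - m ^ 2 + g ^ 2 := by
        linear_combination g ^ 2 * h + m ^ 2 * hE
      nlinarith
    -- m' = x m - g t < m
    have h2 : (x - 1) * m < g * t := by
      apply lt_of_pow_lt_pow_left₀ 2 (by positivity)
      have : (g * t) ^ 2 = (x ^ 2 - 1) * m ^ 2 + g ^ 2 := by
        linear_combination g ^ 2 * h + m ^ 2 * hE
      rw [this]
      have : 0 < m ^ 2 := by positivity
      nlinarith
    -- t' = x t - E g m ≥ 0
    have h3 : 0 ≤ x * t - E * g * m := by
      have : E * g * m ≤ x * t := by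
        apply le_of_sq_le_sq _ (by positivity)
        have : (x * t) ^ 2 = (E * g * m) ^ 2 + E * m ^ 2 + x ^ 2 := by
          linear_combination x ^ 2 * h - E * m ^ 2 * hE
        rw [this]
        have : 0 < m ^ 2 := by positivity
        nlinarith [mul_pos hEpos this, sq_nonneg x]
      omega
    obtain ⟨n, hn1, hn2⟩ := ih (x * t - E * g * m) (x * m - g * t) h3 (by nlinarith)
      (by push_cast at hmN; nlinarith) (by linear_combination h + (t^2 - E * m ^ 2) * hE * (-1))
    refine ⟨n + 1, ?_, ?_⟩
    · rw [lt_succ, ← hn1]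
      linear_combination t * hE + E * g * hn2 + hE * (lu x n)
    · rw [lu_succ, ← hn1]
      linear_combination x * hn2 + m * hE

/-- Part I -/
lemma c_form (k : ℤ) (hk : 0 < k) (c : ℤ) (hc : 1 < c)
    (h1 : ∃ x : ℤ, 8 * k ^ 2 * c - 8 * k ^ 2 = x ^ 2)
    (h2 : ∃ x : ℤ, (8 * k ^ 2 + 1) * c - 8 * k ^ 2 = x ^ 2) :
    ∃ i : ℕ, 1 ≤ i ∧ c = 1 + 2 * (4 * k * lu (16 * k ^ 2 + 1) i) ^ 2 := by
  obtain ⟨x, hx⟩ := h1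
  obtain ⟨t, ht⟩ := h2
  have hd : (2 * k) ∣ x := by
    rw [← Int.pow_dvd_pow_iff (n := 2) (by norm_num)]
    exact ⟨2 * (c - 1), by rw [← hx]; ring⟩
  obtain ⟨w, rfl⟩ := hd
  have hw : 2 * (c - 1) = w ^ 2 := by
    have : (4 * k ^ 2) * (2 * (c - 1)) = (4 * k ^ 2) * w ^ 2 := by linear_combination hx
    exact mul_left_cancel₀ (by positivity) this
  have hd : (2 : ℤ) ∣ w := by
    have : (2 : ℤ) ∣ w ^ 2 := ⟨c - 1, hw.symm⟩
    exact Int.prime_two.dvd_of_dvd_pow this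
  obtain ⟨m, rfl⟩ := hd
  have hm : c = 1 + 2 * m ^ 2 := by linarith
  have hEq : |t| ^ 2 = (16 * k ^ 2 + 2) * |m| ^ 2 + 1 := by
    rw [sq_abs, sq_abs, ← ht, hm]; ring
  have hk2 : 0 < k ^ 2 := by positivity
  obtain ⟨n, hn1, hn2⟩ := lad_complete (16 * k ^ 2 + 1) (16 * k ^ 2 + 2) (4 * k) (by nlinarith) (by linarith)
    (by ring) (by
      intro t m hm0 hm1 h
      have h1 : (4 * k * m) < |t| := by
        apply lt_of_pow_lt_pow_left₀ 2 (abs_nonneg _)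
        rw [sq_abs, h]; nlinarith
      have h2 : |t| < 4 * k * m + 1 := by
        apply lt_of_pow_lt_pow_left₀ 2 (by positivity)
        rw [sq_abs, h]; nlinarith
      omega) (|m|.toNat) |t| |m| (abs_nonneg _) (abs_nonneg _) (Int.self_le_toNat _) hEq
  refine ⟨n, ?_, ?_⟩
  · by_contra h0
    have : n = 0 := by omega
    subst this
    rw [lu_zero, mul_zero] at hn2
    have : m = 0 := abs_eq_zero.mp hn2
    rw [this] at hm; omega
  · rw [hm, ← hn2, sq_abs]

/-- If `A * B` is a square, `A, B` coprime and `A > 0` then `A` is a square. -/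
lemma sq_left {A B y : ℤ} (hA : 0 ≤ A) (hco : IsCoprime A B) (h : A * B = y ^ 2) :
    ∃ s, 0 ≤ s ∧ A = s ^ 2 := by
  obtain ⟨s, hs⟩ := Int.sq_of_isCoprime hco h
  rcases hs with hs | hs
  · exact ⟨|s|, abs_nonneg _, by rw [sq_abs, hs]⟩
  · have : s ^ 2 = 0 := by nlinarith [sq_nonneg s]
    exact ⟨0, le_rfl, by rw [hs, this]; norm_num⟩

/-- no square strictly between consecutive squares -/
lemma not_sq_between {b s : ℤ} (hb : 0 ≤ b) (h1 : b ^ 2 < s ^ 2) (h2 : s ^ 2 < (b + 1) ^ 2) : False := by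
  rw [sq_lt_sq] at h1 h2
  rw [abs_of_nonneg hb] at h1
  rw [abs_of_nonneg (show 0 ≤ b + 1 by omega)] at h2
  omega

/-- Lemma 0 : `c_i - a` square implies `i = 1`. Here `a = 8k^2`, `c_i = 1 + 4 a u_i^2`. -/
lemma good_zero (k : ℤ) (hk : 0 < k) (i : ℕ) (hi : 2 ≤ i) (y : ℤ)
    (h : 1 + 2 * (4 * k * lu (16 * k ^ 2 + 1) i) ^ 2 - 8 * k ^ 2 = y ^ 2) : False := by
  have hk2 : 0 < k ^ 2 := by positivity
  set x : ℤ := 16 * k ^ 2 + 1 with hxdef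
  have hx : 1 ≤ x := by omega
  have hp := lad_pell x i
  rcases Nat.even_or_odd' i with ⟨l, rfl | rfl⟩
  · -- even
    have ht := lt_two_mul x l
    have hul := lu_pos x hx l (by omega)
    set t := lt x (2 * l)
    set v := lu x l
    have e1 : t + 8 * k ^ 2 = (8 * k ^ 2 + 1) * (1 + (8 * k * v) ^ 2) := by
      rw [ht, hxdef]; ring
    have e2 : (t - 8 * k ^ 2) * (1 + (8 * k * v) ^ 2) = y ^ 2 := by
      have : (8 * k ^ 2 + 1) * ((t - 8 * k ^ 2) * (1 + (8 * k * v) ^ 2)) = (8 * k ^ 2 + 1) * y ^ 2 := by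
        rw [← h]
        have : (8 * k ^ 2 + 1) * ((t - 8 * k ^ 2) * (1 + (8 * k * v) ^ 2))
          = (t - 8 * k ^ 2) * (t + 8 * k ^ 2) := by rw [e1]; ring
        rw [this]
        linear_combination hp
      exact mul_left_cancel₀ (by positivity) this
    -- coprimality : t - a = (a+1) w - 2a, with w = 1 + 64 k^2 v^2
    have hco : IsCoprime (1 + (8 * k * v) ^ 2) (t - 8 * k ^ 2) := by
      have e3 : t - 8 * k ^ 2 = -(16 * k ^ 2) + (8 * k ^ 2 + 1) * (1 + (8 * k * v) ^ 2) := by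
        linear_combination e1
      rw [e3]
      apply IsCoprime.add_mul_right_right
      apply IsCoprime.neg_right
      exact ⟨1, -4 * v ^ 2, by ring⟩
    obtain ⟨s, hs, hs2⟩ := sq_left (by positivity) hco (by rw [mul_comm]; exact e2)
    refine not_sq_between (b := 8 * k * v) (s := s) (by positivity) (by linarith) ?_
    rw [← hs2]
    have : 0 < k * v := by positivity
    nlinarith
  · -- odd
    have hl : 1 ≤ l := by omega
    have e0 : 2 * l + 1 = l + (l + 1) := by ring
    have hpl := lad_pell x l
    have hul := lu_pos x hx l hl
    have htl := lt_ge_one x hx l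
    have ht : lt x (2 * l + 1) = lt x l * (x * lt x l + (x ^ 2 - 1) * lu x l)
        + (x ^ 2 - 1) * lu x l * (lt x l + x * lu x l) := by
      rw [e0, lt_add, lt_succ, lu_succ]
    set t := lt x (2 * l + 1)
    set p := lt x l
    set v := lu x l
    set X := p + x * v + v with hX
    set Y := p + x * v - v with hY
    have e1 : t = 2 * (8 * k ^ 2) * X ^ 2 + 1 := by
      rw [ht, hX, hxdef] at *; linear_combination hpl
    have e2 : t = 2 * (8 * k ^ 2 + 1) * Y ^ 2 - 1 := by
      rw [ht, hY, hxdef] at *; linear_combination -hpl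
    have e4 : t - 8 * k ^ 2 = (8 * k ^ 2 + 1) * (2 * Y ^ 2 - 1) := by rw [e2]; ring
    have e3 : (2 * Y ^ 2 - 1) * (t + 8 * k ^ 2) = y ^ 2 := by
      have : (8 * k ^ 2 + 1) * ((2 * Y ^ 2 - 1) * (t + 8 * k ^ 2)) = (8 * k ^ 2 + 1) * y ^ 2 := by
        rw [← h]
        have : (8 * k ^ 2 + 1) * ((2 * Y ^ 2 - 1) * (t + 8 * k ^ 2))
          = (t - 8 * k ^ 2) * (t + 8 * k ^ 2) := by rw [e4]; ring
        rw [this]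
        linear_combination hp
      exact mul_left_cancel₀ (by positivity) this
    have hco : IsCoprime (t + 8 * k ^ 2) (2 * Y ^ 2 - 1) := by
      -- t + a = (a+1) w + 2a ; w coprime to 2a since a*X^2 = (a+1)Y^2-1, so
      have e5 : t + 8 * k ^ 2 = 16 * k ^ 2 + (8 * k ^ 2 + 1) * (2 * Y ^ 2 - 1) := by
        linear_combination e4
      rw [e5]
      apply IsCoprime.add_mul_right_left
      -- (a+1) w = 2aX^2 + 1 - a
      have e6 : (8 * k ^ 2 + 1) * (2 * Y ^ 2 - 1) = 16 * k ^ 2 * X ^ 2 + 1 - 8 * k ^ 2 := by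
        linear_combination e1 - e2
      have h7 : IsCoprime (8 * k ^ 2) (2 * Y ^ 2 - 1) :=
        ⟨1 - 2 * X ^ 2 + (2 * Y ^ 2 - 1), 1, by linear_combination e6⟩
      have h8 : IsCoprime (2:ℤ) (2 * Y ^ 2 - 1) := ⟨Y ^ 2, -1, by ring⟩
      have := h8.mul_left h7
      rw [show (16:ℤ) * k ^ 2 = 2 * (8 * k ^ 2) by ring]; exact this
    have hXpos : k < X := by nlinarith
    obtain ⟨s, hs, hs2⟩ := sq_left (by rw [e1]; positivity) hco (by rw [mul_comm]; exact e3)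
    refine not_sq_between (b := 4 * k * X) (s := s) (by positivity) ?_ ?_
    · rw [← hs2, e1]; nlinarith
    · rw [← hs2, e1]; nlinarith


lemma pell_descent (m K : ℤ) (hm : 1 ≤ m) (hK0 : 0 < K) (hK : K < 2 * m ^ 2 + 1) :
    ∀ N : ℕ, ∀ n z : ℤ, 0 ≤ n → n ≤ N → 0 ≤ z → z ^ 2 = (4 * m ^ 2 + 2) * n ^ 2 + K →
      ∃ n0 z0 : ℤ, 0 ≤ n0 ∧ n0 < m ∧ z0 ^ 2 = (4 * m ^ 2 + 2) * n0 ^ 2 + K ∧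
        (2 * m ∣ n - n0 ∨ 2 * m ∣ n + n0) := by
  intro N
  induction N with
  | zero =>
    intro n z hn hnN hz h
    have : n = 0 := by push_cast at hnN; omega
    subst this
    exact ⟨0, z, le_rfl, by omega, h, Or.inl (by simp)⟩
  | succ N ih =>
    intro n z hn hnN hz h
    by_cases hnm : n < m
    · exact ⟨n, z, hn, hnm, h, Or.inl (by simp)⟩
    push Not at hnm
    have h1 : 2 * m * n < z := by
      apply lt_of_pow_lt_pow_left₀ 2 hz
      rw [h]; nlinarith [sq_nonneg n]
    have h2 : 2 * m * z < (4 * m ^ 2 + 2) * n := by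
      apply lt_of_pow_lt_pow_left₀ 2 (by positivity)
      have e : (2 * m * z) ^ 2 = 4 * m ^ 2 * ((4 * m ^ 2 + 2) * n ^ 2 + K) := by
        rw [← h]; ring
      rw [e]
      have h3 : m ^ 2 * K < (2 * m ^ 2 + 1) * n ^ 2 := by
        have : m ^ 2 ≤ n ^ 2 := by nlinarith
        have hm2 : 0 < m ^ 2 := by positivity
        nlinarith
      nlinarith
    have h2' : (2 * m * z) - (4 * m ^ 2 + 1) * n < n := by linarith
    have h1' : (4 * m ^ 2 + 1) * n - 2 * m * z < n := by nlinarith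
    obtain ⟨n0, z0, a1, a2, a3, a4⟩ := ih |(4 * m ^ 2 + 1) * n - 2 * m * z|
      |(4 * m ^ 2 + 1) * z - 2 * m * (4 * m ^ 2 + 2) * n| (abs_nonneg _)
      (by
        have : |(4 * m ^ 2 + 1) * n - 2 * m * z| < n := by
          rw [abs_lt]; constructor <;> linarith
        push_cast at hnN; omega) (abs_nonneg _)
      (by rw [sq_abs, sq_abs]; linear_combination h)
    refine ⟨n0, z0, a1, a2, a3, ?_⟩
    rcases abs_cases ((4 * m ^ 2 + 1) * n - 2 * m * z) with ⟨e, _⟩ | ⟨e, _⟩ <;> rw [e] at a4 <;>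
    rcases a4 with ⟨q, hq⟩ | ⟨q, hq⟩
    · exact Or.inl ⟨q - 2 * m * n + z, by linear_combination hq⟩
    · exact Or.inr ⟨q - 2 * m * n + z, by linear_combination hq⟩
    · exact Or.inr ⟨-q - 2 * m * n + z, by linear_combination -hq⟩
    · exact Or.inl ⟨-q - 2 * m * n + z, by linear_combination -hq⟩

lemma lu_mod (x : ℤ) (i : ℕ) (hi : 1 ≤ i) : ∀ j : ℕ, ∃ r ≤ i,
    (2 * lu x i ∣ lu x j - lu x r ∨ 2 * lu x i ∣ lu x j + lu x r) := by
  intro j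
  induction j using Nat.strong_induction_on with
  | _ j ih =>
    by_cases h1 : j ≤ i
    · exact ⟨j, h1, Or.inl (by simp)⟩
    by_cases h2 : j ≤ 2 * i
    · obtain ⟨A, rfl⟩ : ∃ A, j = A + i := ⟨j - i, by omega⟩
      obtain ⟨e, rfl⟩ : ∃ e, i = A + e := ⟨i - A, by omega⟩
      exact ⟨e, by omega, Or.inr ⟨lt x A, by rw [lu_reflect]⟩⟩
    · obtain ⟨e, rfl⟩ : ∃ e, j = 2 * i + e := ⟨j - 2 * i, by omega⟩
      obtain ⟨r, hr, hd⟩ := ih e (by omega)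
      have hs := lu_shift x i e
      refine ⟨r, hr, ?_⟩
      rcases hd with ⟨q, hq⟩ | ⟨q, hq⟩
      · exact Or.inl ⟨q + lt x (i + e), by linear_combination hq + hs⟩
      · exact Or.inr ⟨q + lt x (i + e), by linear_combination hq + hs⟩

/-- `m_i = 4 k u_i` -/
def mm (k : ℤ) (i : ℕ) : ℤ := 4 * k * lu (16 * k ^ 2 + 1) i

def GoodP (k : ℤ) (i j : ℕ) : Prop := ∃ z : ℤ,
  (1 + 2 * mm k i ^ 2) * (1 + 2 * mm k j ^ 2) - 8 * k ^ 2 = z ^ 2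

lemma good_descent (k : ℤ) (hk : 0 < k) (i j : ℕ) (hi : 1 ≤ i) (h : GoodP k i j) :
    ∃ r < i, GoodP k r i ∧ (2 * mm k i ∣ mm k j - mm k r ∨ 2 * mm k i ∣ mm k j + mm k r) := by
  obtain ⟨z, hz⟩ := h
  have hk2 : 0 < k ^ 2 := by positivity
  have hx : 1 ≤ 16 * k ^ 2 + 1 := by omega
  have hui := lu_pos _ hx i hi
  have hmi : 4 * k ≤ mm k i := by unfold mm; nlinarith
  have hmj : 0 ≤ mm k j := mul_nonneg (by omega) (lu_nonneg _ hx j)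
  obtain ⟨n0, z0, a1, a2, a3, a4⟩ := pell_descent (mm k i) (2 * mm k i ^ 2 + 1 - 8 * k ^ 2) (by omega)
    (by nlinarith) (by omega) (mm k j).toNat (mm k j) |z| hmj (Int.self_le_toNat _) (abs_nonneg _)
    (by rw [sq_abs, ← hz]; ring)
  obtain ⟨r, hr, hd⟩ := lu_mod (16 * k ^ 2 + 1) i hi j
  have hd' : 2 * mm k i ∣ mm k j - mm k r ∨ 2 * mm k i ∣ mm k j + mm k r := by
    unfold mm
    rcases hd with ⟨q, hq⟩ | ⟨q, hq⟩
    · exact Or.inl ⟨q, by linear_combination 4 * k * hq⟩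
    · exact Or.inr ⟨q, by linear_combination 4 * k * hq⟩
  have hmr0 : 0 ≤ mm k r := mul_nonneg (by omega) (lu_nonneg _ hx r)
  have hmr : mm k r ≤ mm k i := by
    unfold mm
    exact mul_le_mul_of_nonneg_left ((lu_strictMono _ hx).monotone hr) (by omega)
  have key : 2 * mm k i ∣ mm k r - n0 ∨ 2 * mm k i ∣ mm k r + n0 := by
    rcases hd' with ⟨q, h1⟩ | ⟨q, h1⟩ <;> rcases a4 with ⟨s, h2⟩ | ⟨s, h2⟩
    · exact Or.inl ⟨s - q, by linear_combination h2 - h1⟩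
    · exact Or.inr ⟨s - q, by linear_combination h2 - h1⟩
    · exact Or.inr ⟨q - s, by linear_combination h1 - h2⟩
    · exact Or.inl ⟨q - s, by linear_combination h1 - h2⟩
  have heq : mm k r = n0 := by
    rcases key with h1 | h1
    · have := Int.eq_zero_of_abs_lt_dvd h1 (by rw [abs_lt]; constructor <;> omega)
      omega
    · have := Int.eq_zero_of_abs_lt_dvd h1 (by rw [abs_lt]; constructor <;> omega)
      omega
  refine ⟨r, ?_, ⟨z0, ?_⟩, hd'⟩
  · rcases Nat.lt_or_ge r i with h | h
    · exact h
    · have : r = i := by omega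
      subst this; omega
  · rw [a3, heq]; ring

lemma mm_zero (k : ℤ) : mm k 0 = 0 := by simp [mm, lu_zero]
lemma mm_one (k : ℤ) : mm k 1 = 4 * k := by simp [mm, lu_one]

lemma good_reduce (k : ℤ) (hk : 0 < k) : ∀ i j : ℕ, 1 ≤ i → i < j → GoodP k i j →
    ∃ (y z w : ℤ) (j' : ℕ), 2 ≤ j' ∧ 0 < y ∧ y ^ 2 = 24 * k ^ 2 + 1 ∧ 0 ≤ z ∧
      lu (16 * k ^ 2 + 1) j' = 2 * w ∧
      z ^ 2 = 128 * k ^ 2 * (32 * k ^ 2 + 1) * w ^ 2 + y ^ 2 := by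
  intro i
  induction i using Nat.strong_induction_on with
  | _ i ih =>
    intro j hi hij h
    obtain ⟨r, hr, hg, hd⟩ := good_descent k hk i j hi h
    rcases Nat.lt_or_ge i 2 with h1 | h1
    · have : i = 1 := by omega
      subst this
      have : r = 0 := by omega
      subst this
      obtain ⟨y, hy⟩ := hg
      rw [mm_zero, mm_one] at hy
      obtain ⟨z, hz⟩ := h
      rw [mm_zero, mm_one, sub_zero, add_zero, or_self] at hd
      rw [mm_one] at hz
      obtain ⟨w, hw⟩ := hd
      unfold mm at hw
      have hw' : lu (16 * k ^ 2 + 1) j = 2 * w := by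
        have : (4 * k) * lu (16 * k ^ 2 + 1) j = (4 * k) * (2 * w) := by linear_combination hw
        exact mul_left_cancel₀ (by positivity) this
      have hy2 : |y| ^ 2 = 24 * k ^ 2 + 1 := by rw [sq_abs, ← hy]; ring
      refine ⟨|y|, |z|, w, j, by omega, ?_, hy2, abs_nonneg _, hw', ?_⟩
      · rcases (abs_nonneg y).lt_or_eq with h0 | h0
        · exact h0
        · rw [← h0] at hy2; nlinarith [sq_nonneg k]
      · rw [hy2, sq_abs, ← hz]; unfold mm; rw [hw']; ring
    · rcases Nat.eq_zero_or_pos r with h0 | h0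
      · subst h0
        obtain ⟨y, hy⟩ := hg
        rw [mm_zero] at hy
        exact (good_zero k hk i h1 y (by rw [← hy]; unfold mm; ring)).elim
      · exact ih r hr i h0 hr hg

lemma class_descent (x K y : ℤ) (hx : 1 < x) (hy : 0 < y) (hKy : K = y ^ 2) (hK : K < 2 * (x + 1)) :
    ∀ N : ℕ, ∀ z w : ℤ, 0 ≤ z → 0 ≤ w → w ≤ N → z ^ 2 = (x ^ 2 - 1) * w ^ 2 + K →
      ∃ p : ℕ, z = y * lt x p ∧ w = y * lu x p := by
  have base : ∀ z w : ℤ, 0 ≤ z → w = 0 → z ^ 2 = (x ^ 2 - 1) * w ^ 2 + K →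
      ∃ p : ℕ, z = y * lt x p ∧ w = y * lu x p := by
    intro z w hz hw h
    subst hw
    refine ⟨0, ?_, by simp [lu_zero]⟩
    rw [lt_zero, mul_one]
    have : z ^ 2 = y ^ 2 := by rw [h, hKy]; ring
    exact (sq_eq_sq₀ hz hy.le).mp this
  intro N
  induction N with
  | zero =>
    intro z w hz hw hwN h
    exact base z w hz (by push_cast at hwN; omega) h
  | succ N ih =>
    intro z w hz hw hwN h
    rcases hw.lt_or_eq with h0 | h0
    swap
    · exact base z w hz h0.symm h
    have hw2 : 0 < w ^ 2 := by positivity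
    have hK0 : 0 < K := by rw [hKy]; positivity
    have h1 : (x - 1) * w < z := by
      apply lt_of_pow_lt_pow_left₀ 2 hz
      rw [h]; nlinarith
    have h2 : z < (x + 1) * w := by
      apply lt_of_pow_lt_pow_left₀ 2 (by positivity)
      rw [h]; nlinarith
    have h3 : 0 ≤ x * z - (x ^ 2 - 1) * w := by
      have : (x ^ 2 - 1) * w ≤ x * z := by
        apply le_of_sq_le_sq _ (by positivity)
        have : (x * z) ^ 2 = x ^ 2 * ((x ^ 2 - 1) * w ^ 2 + K) := by rw [← h]; ring
        rw [this]
        have : 0 < x ^ 2 - 1 := by nlinarith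
        have := mul_pos this hw2
        have : 0 < x ^ 2 * K := by positivity
        nlinarith
      omega
    obtain ⟨p, hp1, hp2⟩ := ih (x * z - (x ^ 2 - 1) * w) |x * w - z| h3 (abs_nonneg _)
      (by
        have : |x * w - z| < w := by rw [abs_lt]; constructor <;> linarith
        push_cast at hwN; omega)
      (by rw [sq_abs]; linear_combination h)
    rcases abs_cases (x * w - z) with ⟨e, _⟩ | ⟨e, he⟩ <;> rw [e] at hp2
    · refine ⟨p + 1, ?_, ?_⟩
      · rw [lt_succ]; linear_combination x * hp1 + (x ^ 2 - 1) * hp2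
      · rw [lu_succ]; linear_combination hp1 + x * hp2
    · exfalso
      rcases p with _ | p
      · rw [lu_zero] at hp2; omega
      · have hp3 : w = - (y * lu x p) := by
          rw [lt_succ] at hp1
          rw [lu_succ] at hp2
          linear_combination hp1 - x * hp2
        have := mul_nonneg hy.le (lu_nonneg x hx.le p)
        omega

/-- Parts I–III packaged. -/
lemma reduce_main (k : ℤ) (hk : 0 < k) (i j : ℕ) (hi : 1 ≤ i) (hij : i < j) (h : GoodP k i j) :
    ∃ (y : ℤ) (j p : ℕ), 2 ≤ j ∧ 1 ≤ p ∧ 0 < y ∧ y ^ 2 = 24 * k ^ 2 + 1 ∧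
      lu (16 * k ^ 2 + 1) j = 2 * y * lu (64 * k ^ 2 + 1) p := by
  obtain ⟨y, z, w, j', h1, h2, h3, h4, h5, h6⟩ := good_reduce k hk i j hi hij h
  have hk2 : 0 < k ^ 2 := by positivity
  have hw := lu_pos (16 * k ^ 2 + 1) (by omega) j' (by omega)
  obtain ⟨p, hp1, hp2⟩ := class_descent (64 * k ^ 2 + 1) (y ^ 2) y (by omega) h2 rfl (by omega)
    w.toNat z w h4 (by omega) (Int.self_le_toNat _) (by rw [h6]; ring)
  refine ⟨y, j', p, h1, ?_, h2, h3, by rw [h5, hp2]; ring⟩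
  by_contra h0
  have : p = 0 := by omega
  subst this
  rw [lu_zero, mul_zero] at hp2
  omega

/-- Part IV: lower bound `y p > 8 k^2`. -/
lemma p_lower (k : ℤ) (hk : 0 < k) (y : ℤ) (hy : 0 < y) (hy2 : y ^ 2 = 24 * k ^ 2 + 1) (j p : ℕ)
    (hp : 1 ≤ p) (h : lu (16 * k ^ 2 + 1) j = 2 * y * lu (64 * k ^ 2 + 1) p) :
    8 * k ^ 2 < y * p := by
  have hk2 : 0 < k ^ 2 := by positivity
  have hj := (lad_mod (16 * k ^ 2 + 1) j).2
  have hpm := (lad_mod (64 * k ^ 2 + 1) p).2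
  rw [add_sub_cancel_right] at hj hpm
  have hpd : 16 * k ^ 2 ∣ lu (64 * k ^ 2 + 1) p - p := dvd_trans ⟨4, by ring⟩ hpm
  -- j ≤ 2p
  have hjp : j ≤ 2 * p := by
    by_contra hc
    push Not at hc
    obtain ⟨p, rfl⟩ : ∃ p', p = p' + 1 := ⟨p - 1, by omega⟩
    have h1 := lu_le_pow (64 * k ^ 2 + 1) (by omega) p
    have h2 := lu_ge_pow (16 * k ^ 2 + 1) (by omega) (2 * p + 2)
    have h3 := (lu_strictMono (16 * k ^ 2 + 1) (by omega)).monotone (show 2 * p + 2 + 1 ≤ j by omega)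
    have h4 : (2 * (64 * k ^ 2 + 1)) ^ p ≤ ((2 * (16 * k ^ 2 + 1) - 1) ^ 2) ^ p := by
      apply pow_le_pow_left₀ (by positivity); nlinarith
    have h5 : (2 * (16 * k ^ 2 + 1) - 1) ^ (2 * p + 2) =
        ((2 * (16 * k ^ 2 + 1) - 1) ^ 2) ^ p * (2 * (16 * k ^ 2 + 1) - 1) ^ 2 := by rw [pow_add, pow_mul]
    have h6 : 1 ≤ (2 * (64 * k ^ 2 + 1)) ^ p := one_le_pow₀ (by omega)
    have h7 : 2 * y < (2 * (16 * k ^ 2 + 1) - 1) ^ 2 := by nlinarith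
    have h8 : 2 * y * lu (64 * k ^ 2 + 1) (p + 1) ≤ 2 * y * (2 * (64 * k ^ 2 + 1)) ^ p :=
      mul_le_mul_of_nonneg_left h1 (by omega)
    nlinarith
  -- congruence
  have hd : 16 * k ^ 2 ∣ 2 * y * p - j := by
    obtain ⟨q, hq⟩ := hj
    obtain ⟨s, hs⟩ := hpd
    exact ⟨q - 2 * y * s, by linear_combination hq - 2 * y * hs - h⟩
  have hpos : 0 < 2 * y * p - j := by
    have hjp' : (j : ℤ) ≤ 2 * p := by exact_mod_cast hjp
    have hp' : (1 : ℤ) ≤ p := by exact_mod_cast hp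
    have : 1 < y := by nlinarith
    nlinarith
  have hle := Int.le_of_dvd hpos hd
  have hj0 : 0 < j := by
    rcases Nat.eq_zero_or_pos j with h0 | h0
    · subst h0
      rw [lu_zero] at h
      have := lu_pos (64 * k ^ 2 + 1) (by omega) p hp
      nlinarith
    · exact h0
  have : (0 : ℤ) < j := by exact_mod_cast hj0
  nlinarith


lemma sq_mod_three_ne (r : ℤ) (q : ℤ) : r ^ 2 ≠ 3 * q + 2 := by
  intro h
  have : r % 3 = 0 ∨ r % 3 = 1 ∨ r % 3 = 2 := by omega
  rcases this with h3 | h3 | h3 <;>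
  · obtain ⟨s, hs⟩ : ∃ s, r = 3 * s + r % 3 := ⟨r / 3, by omega⟩
    rw [h3] at hs
    rw [hs] at h
    ring_nf at h
    omega

lemma lad_sq_false (x e : ℤ) (hx1 : 1 < x) (hx3 : 3 ∣ x - 2) (hx2 : 2 ∣ x - 1) (he : 0 < e)
    (he2 : IsCoprime 2 e) (hco : ∀ n, IsCoprime (lt x n) e) :
    ∀ n : ℕ, 1 ≤ n → ∀ r w : ℤ, lt x n = r ^ 2 → (lu x n = 3 * e * w ^ 2 ∨ lu x n = 6 * e * w ^ 2) →
      False := by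
  intro n
  obtain ⟨x3, hx3⟩ := hx3
  obtain ⟨x2, hx2⟩ := hx2
  induction n using Nat.strong_induction_on with
  | _ n ih =>
    intro hn r w hr hw
    rcases Nat.even_or_odd' n with ⟨l, rfl | rfl⟩
    · have hl : 1 ≤ l := by omega
      have hp := lad_pell x l
      have hc2 : IsCoprime (lt x l) 2 :=
        ⟨lt x l, -2 * (x2 * (x + 1) * x2 * 0 + x2 * (x2 + 1) * lu x l ^ 2), by
          have : x = 2 * x2 + 1 := by linarith
          rw [this] at hp ⊢; linear_combination hp⟩
      have hc3 : IsCoprime (lt x l) 3 :=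
        ⟨lt x l, -(x3 + 1) * (x - 1) * lu x l ^ 2, by
          have : x = 3 * x3 + 2 := by linarith
          rw [this] at hp ⊢; linear_combination hp⟩
      have hc3e : IsCoprime (lt x l) (3 * e) := hc3.mul_right (hco l)
      have htl := lt_ge_one x hx1.le l
      have hul := lu_pos x hx1.le l hl
      have hcu := lad_coprime x l
      rw [lu_two_mul] at hw
      have hdv : 3 * e ∣ lu x l := by
        have h1 : 3 * e ∣ 2 * lt x l * lu x l := by
          rcases hw with hw | hw
          · exact ⟨w ^ 2, hw⟩
          · exact ⟨2 * w ^ 2, by rw [hw]; ring⟩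
        have h2 : IsCoprime (3 * e) (2 * lt x l) := by
          apply IsCoprime.mul_right _ hc3e.symm
          exact IsCoprime.mul_left (by norm_num) he2.symm
        exact h2.dvd_of_dvd_mul_left h1
      obtain ⟨v, hv⟩ := hdv
      have hv0 : 0 < v := by
        by_contra hc
        have : 3 * e * v ≤ 0 := mul_nonpos_of_nonneg_of_nonpos (by omega) (by omega)
        omega
      have hcv : IsCoprime (lt x l) v := by
        rw [hv] at hcu; exact hcu.of_mul_right_right
      rcases hw with hw | hw
      · have h1 : lt x l * (2 * v) = w ^ 2 := by
          have : (3 * e) * (lt x l * (2 * v)) = (3 * e) * w ^ 2 := by rw [← hw, hv]; ring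
          exact mul_left_cancel₀ (by positivity) this
        have hc := hc2.mul_right hcv
        obtain ⟨s, hs, hs2⟩ := sq_left (by omega) hc h1
        obtain ⟨s', hs', hs2'⟩ := sq_left (by omega) hc.symm (by rw [mul_comm]; exact h1)
        have : (2 : ℤ) ∣ s' := Int.prime_two.dvd_of_dvd_pow ⟨v, hs2'.symm⟩
        obtain ⟨s1, rfl⟩ := this
        exact ih l (by omega) hl s s1 hs2 (Or.inr (by
          have : v = 2 * s1 ^ 2 := by linarith
          rw [hv, this]; ring))
      · have h1 : lt x l * v = w ^ 2 := by
          have : (6 * e) * (lt x l * v) = (6 * e) * w ^ 2 := by rw [← hw, hv]; ring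
          exact mul_left_cancel₀ (by positivity) this
        obtain ⟨s, hs, hs2⟩ := sq_left (by omega) hcv h1
        obtain ⟨s', hs', hs2'⟩ := sq_left (by omega) hcv.symm (by rw [mul_comm]; exact h1)
        exact ih l (by omega) hl s s' hs2 (Or.inl (by rw [hv, hs2']))
    · rw [lt_succ, lt_two_mul] at hr
      have hxx : x = 3 * x3 + 2 := by linarith
      apply sq_mod_three_ne r (x3 + 2 * x * (x3 + 1) * (x - 1) * lu x l ^ 2 + (x3 + 1) * (x - 1) * lu x (2 * l))
      rw [← hr]
      rw [hxx]; ring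

/-- four number lemma -/
lemma four_numbers (A B C D : ℤ) (hA : 0 < A) (h : A * B = C * D) :
    ∃ α β γ δ : ℤ, A = α * β ∧ B = γ * δ ∧ C = α * γ ∧ D = β * δ := by
  have h1 : A ∣ C * D := ⟨B, h.symm⟩
  obtain ⟨α, β, ⟨γ, hγ⟩, ⟨δ, hδ⟩, rfl⟩ := exists_dvd_and_dvd_of_dvd_mul h1
  refine ⟨α, β, γ, δ, rfl, ?_, hγ, hδ⟩
  rw [hγ, hδ] at h
  have : (α * β) * B = (α * β) * (γ * δ) := by linear_combination h
  exact mul_left_cancel₀ hA.ne' this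

lemma hg_cases (a h g s t : ℤ) (hg0 : 0 < g) (hco : IsCoprime g a)
    (hhg : h * g = 3 * a ^ 2) (q : ℤ) (hs : ¬ 2 ∣ s) (ht : ¬ 2 ∣ t) (he : g * s ^ 2 = t ^ 2 + 4 * q) :
    g = 1 ∧ h = 3 * a ^ 2 := by
  have hd : g ∣ 3 := by
    have : g ∣ 3 * a ^ 2 := ⟨h, by linarith⟩
    exact (hco.pow_right (n := 2)).dvd_of_dvd_mul_right this
  have hle := Int.le_of_dvd (by norm_num) hd
  have hgg : g = 1 ∨ g = 3 := by
    interval_cases g <;> omega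
  rcases hgg with rfl | rfl
  · exact ⟨rfl, by linarith⟩
  · exfalso
    obtain ⟨s', hs'⟩ : ∃ s', s = 2 * s' + 1 := ⟨s / 2, by omega⟩
    obtain ⟨t', ht'⟩ : ∃ t', t = 2 * t' + 1 := ⟨t / 2, by omega⟩
    rw [hs', ht'] at he
    ring_nf at he
    omega

lemma odd_of_sq_eq {u q : ℤ} (h : u ^ 2 = 4 * q + 1) : ¬ 2 ∣ u := by
  rintro ⟨v, rfl⟩
  ring_nf at h
  omega

lemma case_odd (a y1 y2 A B X Y : ℤ) (ha : 0 < a) (h3 : 3 ∣ a + 1)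
    (hy : y1 ^ 2 * y2 ^ 2 = 3 * a + 1) (hA : 0 < A) (hX : 0 < X)
    (hAB : A * B = X * Y) (e1 : y1 ^ 2 * A ^ 2 = 4 * a * (a + 1) * y2 ^ 2 * B ^ 2 + 1)
    (e2 : (4 * a + 1) * Y ^ 2 = 4 * a * X ^ 2 + 1) : False := by
  obtain ⟨α, β, γ, δ, rfl, rfl, rfl, rfl⟩ := four_numbers A B X Y hA hAB
  have hα : α ≠ 0 := by rintro rfl; simp at hA
  have hβ : β ≠ 0 := by rintro rfl; simp at hA
  have hy1 : y1 ≠ 0 := by rintro rfl; simp at hy; omega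
  have hδ : δ ≠ 0 := by
    rintro rfl
    have : 0 ≤ 4 * a * (α * γ) ^ 2 := by positivity
    simp at e2; nlinarith
  have c1 : IsCoprime (β ^ 2) (4 * a * γ ^ 2) :=
    ⟨y1 ^ 2 * α ^ 2, -(a + 1) * y2 ^ 2 * δ ^ 2, by linear_combination e1⟩
  have e3 : β ^ 2 * (y1 ^ 2 * α ^ 2 - (4 * a + 1) * δ ^ 2) =
      (4 * a * γ ^ 2) * ((a + 1) * y2 ^ 2 * δ ^ 2 - α ^ 2) := by linear_combination e1 - e2
  obtain ⟨h, hh⟩ : β ^ 2 ∣ (a + 1) * y2 ^ 2 * δ ^ 2 - α ^ 2 :=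
    c1.dvd_of_dvd_mul_left ⟨_, e3.symm⟩
  have hh2 : y1 ^ 2 * α ^ 2 - (4 * a + 1) * δ ^ 2 = 4 * a * γ ^ 2 * h := by
    rw [hh] at e3
    have : β ^ 2 * (y1 ^ 2 * α ^ 2 - (4 * a + 1) * δ ^ 2) = β ^ 2 * (4 * a * γ ^ 2 * h) := by
      linear_combination e3
    exact mul_left_cancel₀ (by positivity) this
  have c2 : IsCoprime (δ ^ 2) (α ^ 2) :=
    ⟨-4 * a * (a + 1) * y2 ^ 2 * γ ^ 2, y1 ^ 2 * β ^ 2, by linear_combination e1⟩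
  obtain ⟨g, hg⟩ : δ ^ 2 ∣ y1 ^ 2 * β ^ 2 + 4 * a * γ ^ 2 := by
    apply c2.dvd_of_dvd_mul_left
    exact ⟨4 * a * (a + 1) * y2 ^ 2 * γ ^ 2 + (4 * a + 1) * β ^ 2, by linear_combination e1 - e2⟩
  have hδ2 : 0 < δ ^ 2 := by positivity
  have hhg : h * g = 3 * a ^ 2 := by
    have : δ ^ 2 * (h * g) = δ ^ 2 * (3 * a ^ 2) := by
      linear_combination (-h) * hg - hh2 - y1 ^ 2 * hh + (a + 1) * δ ^ 2 * hy
    exact mul_left_cancel₀ hδ2.ne' this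
  have hg0 : 0 < g := by
    have : 0 < y1 ^ 2 * β ^ 2 + 4 * a * γ ^ 2 := by positivity
    rw [hg] at this
    exact (mul_pos_iff_of_pos_left hδ2).mp this
  have c3 : IsCoprime g a := by
    have c4 : IsCoprime (y1 ^ 2 * β ^ 2) a :=
      ⟨α ^ 2, -4 * (a + 1) * y2 ^ 2 * (γ * δ) ^ 2, by linear_combination e1⟩
    have c5 : IsCoprime (δ ^ 2 * g) a := by
      rw [← hg]
      have := c4.add_mul_left_left (4 * γ ^ 2)
      rw [show 4 * a * γ ^ 2 = a * (4 * γ ^ 2) by ring]; exact this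
    exact c5.of_mul_left_right
  have o1 : ¬ 2 ∣ y1 * (α * β) :=
    odd_of_sq_eq (q := a * (a + 1) * y2 ^ 2 * (γ * δ) ^ 2) (by linear_combination e1)
  have o2 : ¬ 2 ∣ y1 * β := fun hd => o1 (by rw [mul_left_comm]; exact hd.mul_left _)
  have o3 : ¬ 2 ∣ β * δ :=
    odd_of_sq_eq (q := a * (α * γ) ^ 2 - a * (β * δ) ^ 2) (by linear_combination e2)
  have o4 : ¬ 2 ∣ δ := fun hd => o3 (hd.mul_left _)
  obtain ⟨g1, h1⟩ := hg_cases a h g δ (y1 * β) hg0 c3 hhg (a * γ ^ 2) o4 o2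
    (by linear_combination -hg)
  subst g1 h1
  -- final identity
  have fin : (4 * a + 1) * y1 ^ 2 * β ^ 4 - 16 * a ^ 2 * (a + 1) * y2 ^ 2 * γ ^ 4 = 1 := by
    have hd2 : δ ^ 2 = y1 ^ 2 * β ^ 2 + 4 * a * γ ^ 2 := by linarith
    have ha2 : α ^ 2 = (a + 1) * y2 ^ 2 * δ ^ 2 - 3 * a ^ 2 * β ^ 2 := by linarith
    have : (4 * a + 1) * β ^ 2 * δ ^ 2 - 4 * a * γ ^ 2 * α ^ 2 = 1 := by linear_combination e2
    rw [ha2, hd2] at this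
    linear_combination this + 4 * a * γ ^ 2 * β ^ 2 * (a + 1) * hy
  obtain ⟨b, hb⟩ := h3
  have hab : a = 3 * b - 1 := by omega
  have : (1 : ℤ) = 3 * ((4 * b - 1) * y1 ^ 2 * β ^ 4 - 16 * a ^ 2 * b * y2 ^ 2 * γ ^ 4) := by
    rw [hab] at fin ⊢
    linear_combination -fin
  omega

lemma case_even (a y1 y2 A B X Y : ℤ) (ha : 0 < a)
    (hy : y1 ^ 2 * y2 ^ 2 = 3 * a + 1) (hA : 0 < A) (hX : 0 < X)
    (hAB : A * B = X * Y) (hY : 0 < Y)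
    (e1 : y1 ^ 2 * A ^ 2 = 4 * a * (a + 1) * y2 ^ 2 * B ^ 2 + 1)
    (e2 : X ^ 2 = 4 * a * (4 * a + 1) * Y ^ 2 + 1) : ∃ α δ : ℤ, δ ≠ 0 ∧
      (y1 * α ^ 2) ^ 2 = (a + 1) * (4 * a + 1) * (4 * a * y2 * δ ^ 2) ^ 2 + 1 := by
  obtain ⟨α, β, γ, δ, rfl, rfl, rfl, rfl⟩ := four_numbers A B X Y hA hAB
  have hα : α ≠ 0 := by rintro rfl; simp at hA
  have hβ : β ≠ 0 := by rintro rfl; simp at hA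
  have hδ : δ ≠ 0 := by rintro rfl; simp at hY
  have c1 : IsCoprime (α ^ 2) (4 * a * δ ^ 2) :=
    ⟨y1 ^ 2 * β ^ 2, -(a + 1) * y2 ^ 2 * γ ^ 2, by linear_combination e1⟩
  have e3 : α ^ 2 * (y1 ^ 2 * β ^ 2 - γ ^ 2) =
      (4 * a * δ ^ 2) * ((a + 1) * y2 ^ 2 * γ ^ 2 - (4 * a + 1) * β ^ 2) := by
    linear_combination e1 - e2
  obtain ⟨h, hh⟩ : α ^ 2 ∣ (a + 1) * y2 ^ 2 * γ ^ 2 - (4 * a + 1) * β ^ 2 :=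
    c1.dvd_of_dvd_mul_left ⟨_, e3.symm⟩
  have hh2 : y1 ^ 2 * β ^ 2 - γ ^ 2 = 4 * a * δ ^ 2 * h := by
    rw [hh] at e3
    have : α ^ 2 * (y1 ^ 2 * β ^ 2 - γ ^ 2) = α ^ 2 * (4 * a * δ ^ 2 * h) := by
      linear_combination e3
    exact mul_left_cancel₀ (by positivity) this
  have c2 : IsCoprime (β ^ 2) (γ ^ 2) :=
    ⟨y1 ^ 2 * α ^ 2, -4 * a * (a + 1) * y2 ^ 2 * δ ^ 2, by linear_combination e1⟩
  obtain ⟨g, hg⟩ : β ^ 2 ∣ α ^ 2 + 4 * a * (a + 1) * y2 ^ 2 * δ ^ 2 := by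
    apply c2.dvd_of_dvd_mul_left
    exact ⟨4 * a * (4 * a + 1) * δ ^ 2 + y1 ^ 2 * α ^ 2, by linear_combination e2 - e1⟩
  have hβ2 : 0 < β ^ 2 := by positivity
  have hhg : h * g = 3 * a ^ 2 := by
    have : β ^ 2 * (h * g) = β ^ 2 * (3 * a ^ 2) := by
      linear_combination (-h) * hg - hh - (a + 1) * y2 ^ 2 * hh2 + (a + 1) * β ^ 2 * hy
    exact mul_left_cancel₀ hβ2.ne' this
  have hg0 : 0 < g := by
    have : 0 < α ^ 2 + 4 * a * (a + 1) * y2 ^ 2 * δ ^ 2 := by positivity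
    rw [hg] at this
    exact (mul_pos_iff_of_pos_left hβ2).mp this
  have c3 : IsCoprime g a := by
    have c4 : IsCoprime (α ^ 2) a :=
      ⟨y1 ^ 2 * β ^ 2, -4 * (a + 1) * y2 ^ 2 * (γ * δ) ^ 2, by linear_combination e1⟩
    have c5 : IsCoprime (β ^ 2 * g) a := by
      rw [← hg]
      have := c4.add_mul_left_left (4 * (a + 1) * y2 ^ 2 * δ ^ 2)
      rw [show 4 * a * (a + 1) * y2 ^ 2 * δ ^ 2 = a * (4 * (a + 1) * y2 ^ 2 * δ ^ 2) by ring]; exact this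
    exact c5.of_mul_left_right
  have o1 : ¬ 2 ∣ y1 * (α * β) :=
    odd_of_sq_eq (q := a * (a + 1) * y2 ^ 2 * (γ * δ) ^ 2) (by linear_combination e1)
  have o2 : ¬ 2 ∣ α := fun hd => o1 ((hd.mul_right _).mul_left _)
  have o4 : ¬ 2 ∣ β := fun hd => o1 ((hd.mul_left _).mul_left _)
  obtain ⟨g1, h1⟩ := hg_cases a h g β α hg0 c3 hhg (a * (a + 1) * y2 ^ 2 * δ ^ 2) o4 o2
    (by linear_combination -hg)
  subst g1 h1
  refine ⟨α, δ, hδ, ?_⟩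
  have hb2 : β ^ 2 = α ^ 2 + 4 * a * (a + 1) * y2 ^ 2 * δ ^ 2 := by linarith
  have hc2 : γ ^ 2 = y1 ^ 2 * β ^ 2 - 4 * a * δ ^ 2 * (3 * a ^ 2) := by linarith
  have : y1 ^ 2 * α ^ 2 * β ^ 2 - 4 * a * (a + 1) * y2 ^ 2 * δ ^ 2 * γ ^ 2 = 1 := by
    linear_combination e1
  rw [hc2, hb2] at this
  linear_combination this + 16 * a ^ 2 * (a + 1) ^ 2 * y2 ^ 2 * δ ^ 4 * hy


lemma small_aux (k x D' y1 y2 A B : ℤ) (l p : ℕ) (hk : 0 < k) (hy1 : 0 < y1) (hy2 : 0 < y2)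
    (hy : y1 ^ 2 * y2 ^ 2 = 24 * k ^ 2 + 1) (hk3 : 3 ∣ 8 * k ^ 2 + 1)
    (hD : 9 * D' = (8 * k ^ 2 + 1) * (32 * k ^ 2 + 1)) (hx : 16 * D' = x ^ 2 - 1)
    (hx1 : 1 < x)
    (hno : ∀ t m : ℤ, 0 < m → m < 4 → t ^ 2 ≠ D' * m ^ 2 + 1)
    (hp : 1 ≤ p) (h1 : lt (16 * k ^ 2 + 1) l = y1 * A) (h2 : lu (16 * k ^ 2 + 1) l = y2 * B)
    (h3 : A * B = lu (64 * k ^ 2 + 1) p) :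
    ∃ (n : ℕ) (α δ : ℤ), 1 ≤ n ∧ lt x n = y1 * α ^ 2 ∧ lu x n = 24 * k ^ 2 * y2 * δ ^ 2 := by
  have hk2 : 0 < k ^ 2 := by positivity
  have hpl := lad_pell (16 * k ^ 2 + 1) l
  have htl := lt_ge_one (16 * k ^ 2 + 1) (by omega) l
  have hA : 0 < A := by
    rw [h1] at htl
    exact (mul_pos_iff_of_pos_left hy1).mp (by omega)
  rw [h1, h2] at hpl
  have e1 : y1 ^ 2 * A ^ 2 = 4 * (8 * k ^ 2) * (8 * k ^ 2 + 1) * y2 ^ 2 * B ^ 2 + 1 := by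
    linear_combination hpl
  rcases Nat.even_or_odd' p with ⟨q, rfl | rfl⟩
  · have hq := lad_pell (64 * k ^ 2 + 1) q
    have htq := lt_ge_one (64 * k ^ 2 + 1) (by omega) q
    have huq := lu_pos (64 * k ^ 2 + 1) (by omega) q (by omega)
    rw [lu_two_mul] at h3
    obtain ⟨α, δ, hδ, hh⟩ := case_even (8 * k ^ 2) y1 y2 A B (lt (64 * k ^ 2 + 1) q)
      (2 * lu (64 * k ^ 2 + 1) q) (by positivity) (by rw [hy]; ring) hA (by omega)
      (by rw [h3]; ring) (by omega) e1 (by linear_combination hq)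
    obtain ⟨n, hn1, hn2⟩ := lad_complete x D' 4 hx1 (by norm_num) (by linarith) hno
      (12 * (8 * k ^ 2) * y2 * δ ^ 2).toNat (y1 * α ^ 2) (12 * (8 * k ^ 2) * y2 * δ ^ 2)
      (by positivity) (by positivity) (Int.self_le_toNat _)
      (by rw [hh]; linear_combination (-16) * (8 * k ^ 2 * y2 * δ ^ 2) ^ 2 * hD)
    have hn3 : lu x n = 24 * k ^ 2 * y2 * δ ^ 2 := by linarith
    refine ⟨n, α, δ, ?_, hn1.symm, hn3⟩
    by_contra h0
    have : n = 0 := by omega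
    subst this
    rw [lu_zero] at hn3
    have : 0 < 24 * k ^ 2 * y2 * δ ^ 2 := by positivity
    omega
  · exfalso
    have hq := lad_pell (64 * k ^ 2 + 1) q
    have htq := lt_ge_one (64 * k ^ 2 + 1) (by omega) q
    have huq := lu_nonneg (64 * k ^ 2 + 1) (by omega) q
    have e0 : 2 * q + 1 = q + (q + 1) := by ring
    rw [e0, lu_add, lt_succ, lu_succ] at h3
    set P := lt (64 * k ^ 2 + 1) q
    set U := lu (64 * k ^ 2 + 1) q
    refine case_odd (8 * k ^ 2) y1 y2 A B (P + (64 * k ^ 2 + 1) * U + U) (P + (64 * k ^ 2 + 1) * U - U)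
      (by positivity) hk3 (by rw [hy]; ring) hA (by positivity) ?_ e1 ?_
    · rw [h3]; linear_combination hq * 0
    · linear_combination hq

/-- Small cases `k = 1, 10` with `a = 8 k^2`. -/
lemma small_case (k y x e f D' : ℤ) (hk : 0 < k) (hy : 0 < y)
    (hy2 : y ^ 2 = 24 * k ^ 2 + 1) (hk3 : 3 ∣ 8 * k ^ 2 + 1)
    (hsplit : ∀ A B : ℤ, IsCoprime A B → y ∣ A * B → y ∣ A ∨ y ∣ B)
    (hD : 9 * D' = (8 * k ^ 2 + 1) * (32 * k ^ 2 + 1)) (hx : 16 * D' = x ^ 2 - 1)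
    (hx1 : 1 < x) (hx3 : 3 ∣ x - 2) (hx2 : 2 ∣ x - 1) (he : 0 < e)
    (he2 : IsCoprime 2 e) (hco : ∀ n, IsCoprime (lt x n) e)
    (hno : ∀ t m : ℤ, 0 < m → m < 4 → t ^ 2 ≠ D' * m ^ 2 + 1)
    (hyf : y = e * f ^ 2)
    (hysq : (∃ r, y = r ^ 2) ∨ ∀ n, ¬ y ∣ lt x n)
    (j p : ℕ) (hp : 1 ≤ p) (h : lu (16 * k ^ 2 + 1) j = 2 * y * lu (64 * k ^ 2 + 1) p) : False := by
  have hk2 : 0 < k ^ 2 := by positivity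
  have hj : ∃ l, j = 2 * l := by
    obtain ⟨q, hq⟩ := (lad_mod (16 * k ^ 2 + 1) j).2
    rw [h] at hq
    have : (j : ℤ) = 2 * (y * lu (64 * k ^ 2 + 1) p - 8 * k ^ 2 * q) := by linear_combination -hq
    exact ⟨j / 2, by omega⟩
  obtain ⟨l, rfl⟩ := hj
  rw [lu_two_mul] at h
  have h' : lt (16 * k ^ 2 + 1) l * lu (16 * k ^ 2 + 1) l = y * lu (64 * k ^ 2 + 1) p := by linarith
  rcases hsplit _ _ (lad_coprime (16 * k ^ 2 + 1) l) ⟨_, h'⟩ with ⟨A, hA⟩ | ⟨B, hB⟩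
  · obtain ⟨n, α, δ, hn, hn1, hn2⟩ := small_aux k x D' y 1 A (lu (16 * k ^ 2 + 1) l) l p hk hy one_pos
      (by rw [← hy2]; ring) hk3 hD hx hx1 hno hp hA (by ring) (by
        rw [hA] at h'
        have : y * (A * lu (16 * k ^ 2 + 1) l) = y * lu (64 * k ^ 2 + 1) p := by rw [← h']; ring
        exact mul_left_cancel₀ hy.ne' this)
    rcases hysq with ⟨r, hr⟩ | hnd
    · exact lad_sq_false x 1 hx1 hx3 hx2 one_pos (isCoprime_one_right) (fun _ => isCoprime_one_right) n hn
        (r * α) (2 * k * δ) (by rw [hn1, hr]; ring) (Or.inr (by rw [hn2]; ring))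
    · exact hnd n ⟨_, hn1⟩
  · obtain ⟨n, α, δ, hn, hn1, hn2⟩ := small_aux k x D' 1 y (lt (16 * k ^ 2 + 1) l) B l p hk one_pos hy
      (by rw [← hy2]; ring) hk3 hD hx hx1 hno hp (by ring) hB (by
        rw [hB] at h'
        have : y * (lt (16 * k ^ 2 + 1) l * B) = y * lu (64 * k ^ 2 + 1) p := by rw [← h']; ring
        exact mul_left_cancel₀ hy.ne' this)
    exact lad_sq_false x e hx1 hx3 hx2 he he2 hco n hn
        α (2 * k * f * δ) (by rw [hn1]; ring) (Or.inr (by rw [hn2, hyf]; ring))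

lemma case_one (j p : ℕ) (hp : 1 ≤ p)
    (h : lu (16 * 1 ^ 2 + 1) j = 2 * 5 * lu (64 * 1 ^ 2 + 1) p) : False := by
  have hp5 : Prime (5 : ℤ) := by norm_num
  have h5 : ∀ n, ¬ (5 : ℤ) ∣ lt 23 n := by
    rintro n ⟨q, hq⟩
    have hp := lad_pell 23 n
    rw [hq] at hp
    have h5 : lu 23 n % 5 = 0 ∨ lu 23 n % 5 = 1 ∨ lu 23 n % 5 = 2 ∨ lu 23 n % 5 = 3 ∨ lu 23 n % 5 = 4 := by
      omega
    obtain ⟨s, hs⟩ : ∃ s, lu 23 n = 5 * s + lu 23 n % 5 := ⟨lu 23 n / 5, by omega⟩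
    rcases h5 with h5 | h5 | h5 | h5 | h5 <;> rw [h5] at hs <;> rw [hs] at hp <;> ring_nf at hp <;> omega
  refine small_case 1 5 23 5 1 33 (by norm_num) (by norm_num) (by norm_num) (by norm_num)
    (fun A B _ hd => hp5.dvd_or_dvd hd) (by norm_num) (by norm_num) (by norm_num) (by norm_num)
    (by norm_num) (by norm_num) (by norm_num) ?_ ?_ (by norm_num) (Or.inr h5) j p hp h
  · intro n
    exact ((Prime.coprime_iff_not_dvd hp5).mpr (h5 n)).symm
  · intro t m h0 h4 ht
    have : m = 1 ∨ m = 2 ∨ m = 3 := by omega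
    rcases this with rfl | rfl | rfl
    · exact not_sq_between (b := 5) (s := t) (by norm_num) (by rw [ht]; norm_num) (by rw [ht]; norm_num)
    · exact not_sq_between (b := 11) (s := t) (by norm_num) (by rw [ht]; norm_num) (by rw [ht]; norm_num)
    · exact not_sq_between (b := 17) (s := t) (by norm_num) (by rw [ht]; norm_num) (by rw [ht]; norm_num)

lemma case_ten (j p : ℕ) (hp : 1 ≤ p)
    (h : lu (16 * 10 ^ 2 + 1) j = 2 * 49 * lu (64 * 10 ^ 2 + 1) p) : False := by
  have hp7 : Prime (7 : ℤ) := by norm_num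
  refine small_case 10 49 2135 1 7 284889 (by norm_num) (by norm_num) (by norm_num) (by norm_num)
    ?_ (by norm_num) (by norm_num) (by norm_num) (by norm_num)
    (by norm_num) (by norm_num) (by norm_num) (fun _ => isCoprime_one_right) ?_ (by norm_num)
    (Or.inl ⟨7, by norm_num⟩) j p hp h
  · intro A B hco hd
    by_cases h7 : (7 : ℤ) ∣ A
    · left
      have h7B : IsCoprime (7 : ℤ) B := hco.of_isCoprime_of_dvd_left h7
      have : IsCoprime ((7 : ℤ) ^ 2) B := h7B.pow_left
      norm_num at this
      exact this.dvd_of_dvd_mul_right hd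
    · right
      have h7A : IsCoprime (7 : ℤ) A := (Prime.coprime_iff_not_dvd hp7).mpr h7
      have : IsCoprime ((7 : ℤ) ^ 2) A := h7A.pow_left
      norm_num at this
      exact this.dvd_of_dvd_mul_left hd
  · intro t m h0 h4 ht
    have : m = 1 ∨ m = 2 ∨ m = 3 := by omega
    rcases this with rfl | rfl | rfl
    · exact not_sq_between (b := 533) (s := t) (by norm_num) (by rw [ht]; norm_num) (by rw [ht]; norm_num)
    · exact not_sq_between (b := 1067) (s := t) (by norm_num) (by rw [ht]; norm_num) (by rw [ht]; norm_num)
    · exact not_sq_between (b := 1601) (s := t) (by norm_num) (by rw [ht]; norm_num) (by rw [ht]; norm_num)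


open PowerSeries in
/-- the germ `d + w` -/
noncomputable def lin (d : ℝ) : PowerSeries ℝ := C d + X

/-- nodes -/
noncomputable def nd : Fin 3 → ℝ := ![0, 1, 4]

/-- germ of `∏_{l ≠ j} (z - a_l)^{-m_l}` at `a_j` -/
noncomputable def Bser (m : Fin 3 → ℕ) (j : Fin 3) : PowerSeries ℝ :=
  ∏ l ∈ Finset.univ.erase j, ((lin (nd j - nd l))⁻¹) ^ (m l)

/-- sum of residues of `F / ∏ (z-a_l)^{m_l}` -/
noncomputable def Lam (m : Fin 3 → ℕ) (F : Fin 3 → PowerSeries ℝ) : ℝ :=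
  ∑ j, if m j = 0 then 0 else PowerSeries.coeff (m j - 1) (F j * Bser m j)

/-- germ of `z` -/
noncomputable def zg : Fin 3 → PowerSeries ℝ := fun j => lin (nd j)

lemma nd_inj {i j : Fin 3} (h : i ≠ j) : nd i - nd j ≠ 0 := by
  fin_cases i <;> fin_cases j <;> simp_all [nd] <;> norm_num

lemma constCoeff_lin (d : ℝ) : PowerSeries.constantCoeff (lin d) = d := by simp [lin]

lemma lin_mul_inv {d : ℝ} (hd : d ≠ 0) : lin d * (lin d)⁻¹ = 1 :=
  PowerSeries.mul_inv_cancel _ (by rwa [constCoeff_lin])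

lemma Lam_add (m : Fin 3 → ℕ) (F G : Fin 3 → PowerSeries ℝ) : Lam m (F + G) = Lam m F + Lam m G := by
  unfold Lam
  rw [← Finset.sum_add_distrib]
  refine Finset.sum_congr rfl fun j _ => ?_
  split_ifs
  · simp
  · simp [add_mul]

lemma Lam_smul (m : Fin 3 → ℕ) (c : ℝ) (F : Fin 3 → PowerSeries ℝ) : Lam m (c • F) = c * Lam m F := by
  unfold Lam
  rw [Finset.mul_sum]
  refine Finset.sum_congr rfl fun j _ => ?_
  split_ifs
  · simp
  · simp

lemma Lam_sub (m : Fin 3 → ℕ) (F G : Fin 3 → PowerSeries ℝ) : Lam m (F - G) = Lam m F - Lam m G := by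
  have : F - G = F + (-1 : ℝ) • G := by rw [neg_one_smul, sub_eq_add_neg]
  rw [this, Lam_add, Lam_smul]; ring

/-- lowering the multiplicity at `l` by one -/
def low (m : Fin 3 → ℕ) (l : Fin 3) : Fin 3 → ℕ := Function.update m l (m l - 1)

lemma Lam_step (m : Fin 3 → ℕ) (l : Fin 3) (hl : m l ≠ 0) (F : Fin 3 → PowerSeries ℝ) :
    Lam m (zg * F - nd l • F) = Lam (low m l) F := by
  unfold Lam
  refine Finset.sum_congr rfl fun j _ => ?_
  have e0 : (zg * F - nd l • F) j = lin (nd j - nd l) * F j := by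
    simp only [Pi.sub_apply, Pi.mul_apply, Pi.smul_apply, zg, lin, PowerSeries.smul_eq_C_mul,
      map_sub]
    ring
  rw [e0]
  by_cases hj : j = l
  · subst hj
    have hB : Bser (low m j) j = Bser m j := by
      unfold Bser
      refine Finset.prod_congr rfl fun i hi => ?_
      have : i ≠ j := (Finset.mem_erase.mp hi).1
      simp [low, Function.update_of_ne this]
    rw [hB]
    have hX : lin (nd j - nd j) = PowerSeries.X := by simp [lin]
    have hlow : low m j j = m j - 1 := by simp [low]
    rw [if_neg hl, hX, hlow, mul_assoc]
    rcases h : m j - 1 with _ | q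
    · simp
    · rw [PowerSeries.coeff_succ_X_mul]; simp
  · have hlow : low m l j = m j := by simp [low, Function.update_of_ne hj]
    rw [hlow]
    split_ifs with h0
    · rfl
    · congr 1
      have hmem : l ∈ Finset.univ.erase j := by simp [Ne.symm hj]
      unfold Bser
      rw [← Finset.mul_prod_erase _ _ hmem, ← Finset.mul_prod_erase _ _ hmem]
      have hrest : ∏ x ∈ (Finset.univ.erase j).erase l, ((lin (nd j - nd x))⁻¹) ^ (low m l x) =
          ∏ x ∈ (Finset.univ.erase j).erase l, ((lin (nd j - nd x))⁻¹) ^ (m x) := by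
        refine Finset.prod_congr rfl fun i hi => ?_
        have : i ≠ l := (Finset.mem_erase.mp hi).1
        simp [low, Function.update_of_ne this]
      rw [hrest]
      have hll : low m l l = m l - 1 := by simp [low]
      rw [hll]
      obtain ⟨q, hq⟩ : ∃ q, m l = q + 1 := ⟨m l - 1, by omega⟩
      rw [hq, Nat.add_sub_cancel, pow_succ]
      have := lin_mul_inv (nd_inj hj)
      calc _ = (lin (nd j - nd l) * (lin (nd j - nd l))⁻¹) * (F j * ((lin (nd j - nd l))⁻¹ ^ q *
            ∏ x ∈ (Finset.univ.erase j).erase l, ((lin (nd j - nd x))⁻¹) ^ (m x))) := by ring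
        _ = _ := by rw [this, one_mul]

lemma sum_low (m : Fin 3 → ℕ) (l : Fin 3) (hl : m l ≠ 0) : ∑ j, low m l j + 1 = ∑ j, m j := by
  unfold low
  rw [Finset.sum_update_of_mem (Finset.mem_univ l)]
  rw [← Finset.add_sum_erase _ m (Finset.mem_univ l)]
  rw [Finset.sdiff_singleton_eq_erase]
  omega

lemma Lam_zero (F : Fin 3 → PowerSeries ℝ) (m : Fin 3 → ℕ) (hm : ∑ j, m j = 0) : Lam m F = 0 := by
  unfold Lam
  refine Finset.sum_eq_zero fun j _ => ?_
  rw [if_pos]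
  exact (Finset.sum_eq_zero_iff.mp hm) j (Finset.mem_univ j)

lemma Lam_single (m : Fin 3 → ℕ) (l : Fin 3) (hm : ∀ j, j ≠ l → m j = 0) (hl : m l ≠ 0)
    (F : Fin 3 → PowerSeries ℝ) : Lam m F = PowerSeries.coeff (m l - 1) (F l) := by
  unfold Lam
  rw [Finset.sum_eq_single l]
  · rw [if_neg hl]
    have : Bser m l = 1 := by
      unfold Bser
      refine Finset.prod_eq_one fun i hi => ?_
      rw [hm i (Finset.mem_erase.mp hi).1, pow_zero]
    rw [this, mul_one]
  · intro j _ hj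
    rw [if_pos (hm j hj)]
  · simp

lemma Lam_one : ∀ (s : ℕ) (m : Fin 3 → ℕ), ∑ j, m j = s + 1 →
    Lam m 1 = if s = 0 then 1 else 0 := by
  intro s
  induction s with
  | zero =>
    intro m hm
    obtain ⟨l, hl⟩ : ∃ l, m l ≠ 0 := by
      by_contra hc
      push Not at hc
      simp [hc] at hm
    have h1 := sum_low m l hl
    have h2 : ∀ j, low m l j = 0 := fun j =>
      (Finset.sum_eq_zero_iff.mp (show ∑ j, low m l j = 0 by omega)) j (Finset.mem_univ j)
    have h3 : ∀ j, j ≠ l → m j = 0 := by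
      intro j hj
      have := h2 j
      simpa [low, Function.update_of_ne hj] using this
    have h4 : m l - 1 = 0 := by simpa [low] using h2 l
    rw [Lam_single m l h3 hl, h4]
    simp
  | succ s ih =>
    intro m hm
    rw [if_neg (by omega)]
    obtain ⟨l, hl⟩ : ∃ l, m l ≠ 0 := by
      by_contra hc
      push Not at hc
      simp [hc] at hm
    by_cases hs : ∀ j, j ≠ l → m j = 0
    · rw [Lam_single m l hs hl]
      have : m l = s + 1 + 1 := by
        rw [← hm, Finset.sum_eq_single l]
        · intro j _ hj; exact hs j hj
        · simp
      rw [this]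
      simp [PowerSeries.coeff_one]
    · push Not at hs
      obtain ⟨l', hl', hm'⟩ := hs
      have h1 := Lam_step m l hl 1
      have h2 := Lam_step m l' hm' 1
      rw [ih _ (by have := sum_low m l hl; omega), Lam_sub, Lam_smul] at h1
      rw [ih _ (by have := sum_low m l' hm'; omega), Lam_sub, Lam_smul] at h2
      have h3 : (nd l' - nd l) * Lam m 1 = 0 := by linarith
      exact (mul_eq_zero.mp h3).resolve_left (nd_inj hl')

lemma nd_bounds (l : Fin 3) : 0 ≤ nd l ∧ nd l ≤ 4 := by
  fin_cases l <;> simp [nd] <;> norm_num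

lemma Lam_pow_bound : ∀ (h s : ℕ) (m : Fin 3 → ℕ), ∑ j, m j = s + 1 →
    0 ≤ Lam m (zg ^ h) ∧ Lam m (zg ^ h) ≤ (h.choose s : ℝ) * 4 ^ h / 4 ^ s := by
  intro h
  induction h with
  | zero =>
    intro s m hm
    rw [pow_zero, Lam_one s m hm]
    rcases s with _ | s
    · simp
    · simp
  | succ h ih =>
    intro s m hm
    obtain ⟨l, hl⟩ : ∃ l, m l ≠ 0 := by
      by_contra hc
      push Not at hc
      simp [hc] at hm
    have h1 := Lam_step m l hl (zg ^ h)
    rw [Lam_sub, Lam_smul, ← pow_succ'] at h1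
    have h2 := sum_low m l hl
    obtain ⟨n0, n4⟩ := nd_bounds l
    obtain ⟨i1, i2⟩ := ih s m hm
    have e : Lam m (zg ^ (h + 1)) = Lam (low m l) (zg ^ h) + nd l * Lam m (zg ^ h) := by linarith
    have b1 : nd l * Lam m (zg ^ h) ≤ 4 * ((h.choose s : ℝ) * 4 ^ h / 4 ^ s) :=
      mul_le_mul n4 i2 i1 (by norm_num)
    have b0 : 0 ≤ nd l * Lam m (zg ^ h) := mul_nonneg n0 i1
    rcases s with _ | s
    · rw [e, Lam_zero _ (low m l) (by omega)]
      constructor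
      · linarith
      · simp only [Nat.choose_zero_right, pow_zero] at b1 ⊢
        rw [pow_succ]; linarith
    · obtain ⟨j1, j2⟩ := ih s (low m l) (by omega)
      rw [e]
      constructor
      · linarith
      · rw [Nat.choose_succ_succ]
        push_cast
        have : ((h.choose s : ℝ) + (h.choose (s + 1) : ℝ)) * 4 ^ (h + 1) / 4 ^ (s + 1) =
          (h.choose s : ℝ) * 4 ^ h / 4 ^ s + 4 * ((h.choose (s + 1) : ℝ) * 4 ^ h / 4 ^ (s + 1)) := by
          rw [pow_succ, pow_succ]; field_simp
        rw [this]; linarith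

/-- vanishing descends -/
lemma Lam_vanish_low (F : Fin 3 → PowerSeries ℝ) (m : Fin 3 → ℕ) (l : Fin 3) (hl : m l ≠ 0)
    (h : ∀ q : ℕ, Lam m (zg ^ q * F) = 0) : ∀ q : ℕ, Lam (low m l) (zg ^ q * F) = 0 := by
  intro q
  rw [← Lam_step m l hl, Lam_sub, Lam_smul, h q, ← mul_assoc, ← pow_succ', h (q + 1)]
  simp

lemma Lam_vanish (F : Fin 3 → PowerSeries ℝ) : ∀ (s : ℕ) (m : Fin 3 → ℕ), ∑ j, m j = s + 1 →
    m 0 ≠ 0 → (∀ q : ℕ, Lam m (zg ^ q * F) = 0) → PowerSeries.coeff 0 (F 0) = 0 := by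
  intro s
  induction s with
  | zero =>
    intro m hm h0 h
    have h1 := h 0
    rw [Fin.sum_univ_three] at hm
    rw [Lam_single m 0 (by intro j hj; fin_cases j <;> simp_all <;> omega) h0] at h1
    have : m 0 - 1 = 0 := by omega
    rw [this] at h1
    simpa using h1
  | succ s ih =>
    intro m hm h0 h
    rcases Nat.lt_or_ge 1 (m 0) with hc | hc
    · have := sum_low m 0 h0
      refine ih (low m 0) (by omega) ?_ (Lam_vanish_low F m 0 h0 h)
      simp [low]; omega
    · obtain ⟨l, hl, hl0⟩ : ∃ l, m l ≠ 0 ∧ l ≠ 0 := by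
        rw [Fin.sum_univ_three] at hm
        by_cases h1 : m 1 = 0
        · exact ⟨2, by omega, by decide⟩
        · exact ⟨1, h1, by decide⟩
      have := sum_low m l hl
      refine ih (low m l) (by omega) ?_ (Lam_vanish_low F m l hl h)
      simpa [low, Function.update_of_ne hl0.symm] using h0


lemma rc_rec (s : ℝ) (r : ℕ) : Ring.choose s (r+1) * (r+1) = Ring.choose s r * (s - r) := by
  have h := Ring.choose_smul_choose s (Nat.le_succ r)
  simp only [Nat.succ_eq_add_one, Nat.choose_succ_self_right, Nat.add_sub_cancel_left,
    Ring.choose_one_right, nsmul_eq_mul] at h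
  push_cast at h
  linarith

/-- germ of `(M + w)^(n+1/2) / sqrt M` -/
noncomputable def Gs (n : ℕ) (M : ℝ) : PowerSeries ℝ :=
  PowerSeries.mk fun r => Ring.choose ((n:ℝ) + 1/2) r * (M ^ n * (M⁻¹) ^ r)

lemma coeff_lin_mul (d : ℝ) (F : PowerSeries ℝ) (r : ℕ) :
    PowerSeries.coeff (r+1) (lin d * F) = d * PowerSeries.coeff (r+1) F + PowerSeries.coeff r F := by
  simp [lin, add_mul, PowerSeries.coeff_succ_X_mul]

lemma coeff_lin_mul_zero (d : ℝ) (F : PowerSeries ℝ) :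
    PowerSeries.coeff 0 (lin d * F) = d * PowerSeries.coeff 0 F := by
  simp [lin, add_mul]

lemma Gs_deriv (n : ℕ) (M : ℝ) (hM : M ≠ 0) :
    lin M * PowerSeries.derivative ℝ (Gs n M) = PowerSeries.C ((n:ℝ) + 1/2) * Gs n M := by
  ext r
  cases r with
  | zero =>
    rw [coeff_lin_mul_zero]
    simp only [PowerSeries.coeff_derivative, Gs, PowerSeries.coeff_mk, PowerSeries.coeff_C_mul]
    simp
    field_simp
  | succ r =>
    rw [coeff_lin_mul]
    simp only [PowerSeries.coeff_derivative, Gs, PowerSeries.coeff_mk, PowerSeries.coeff_C_mul]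
    have h := rc_rec ((n:ℝ) + 1/2) (r+1)
    push_cast at h ⊢
    have e : M * (M⁻¹)^(r+1+1) = (M⁻¹)^(r+1) := by rw [pow_succ (M⁻¹) (r+1)]; field_simp
    linear_combination (M^n * (M⁻¹)^(r+1)) * h + Ring.choose ((n:ℝ)+1/2) (r+1+1) * (r+1+1) * M^n * e

lemma coeff_euler (n : ℕ) (H : PowerSeries ℝ) :
    PowerSeries.coeff n (PowerSeries.X * PowerSeries.derivative ℝ H - PowerSeries.C (n:ℝ) * H) = 0 := by
  cases n with
  | zero => simp
  | succ n =>
    rw [map_sub, PowerSeries.coeff_succ_X_mul, PowerSeries.coeff_derivative, PowerSeries.coeff_C_mul]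
    push_cast; ring

lemma lin_deriv (d : ℝ) : PowerSeries.derivative ℝ (lin d) = 1 := by
  simp [lin]

lemma deriv_mul' (f g : PowerSeries ℝ) : PowerSeries.derivative ℝ (f * g) =
    f * PowerSeries.derivative ℝ g + g * PowerSeries.derivative ℝ f := by
  simp [Derivation.leibniz]

/-- coefficients of the recurrence -/
noncomputable def qc3 (n h : ℕ) : ℝ := h - 2*n + 3/2
noncomputable def qc2 (n h : ℕ) (N : ℝ) : ℝ := -5*(n+3/2) - 5*h + 10*n + N*(h-3*n)
noncomputable def qc1 (n h : ℕ) (N : ℝ) : ℝ := 4*(n+3/2) + 4*h - 4*n + N*(-5*h+10*n)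
noncomputable def qc0 (n h : ℕ) (N : ℝ) : ℝ := N*(4*h-4*n)

open PowerSeries in
lemma node_rec (n h : ℕ) (N a d1 d2 : ℝ) (h1 : d1 ≠ 0) (h2 : d2 ≠ 0) (hM : N + a ≠ 0)
    (e1 : d1 + d2 = 3*a - 5) (e2 : d1*d2 = 3*a^2 - 10*a + 4) (e3 : a^3 - 5*a^2 + 4*a = 0) :
    coeff n ((C (qc3 n h) * lin a^(h+3) + C (qc2 n h N) * lin a^(h+2) + C (qc1 n h N) * lin a^(h+1)
      + C (qc0 n h N) * lin a^h) * Gs n (N+a) * ((lin d1)⁻¹^(n+1) * (lin d2)⁻¹^(n+1))) = 0 := by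
  have hA := lin_mul_inv h1
  have hB := lin_mul_inv h2
  have hG := Gs_deriv n (N+a) hM
  have key := coeff_euler n (lin a^h * (lin (N+a) * Gs n (N+a)) * ((lin d1)⁻¹^n * (lin d2)⁻¹^n))
  rw [← key]
  congr 1
  have hZ : (lin a) * derivative ℝ (lin a ^ h) = C (h:ℝ) * lin a ^ h := by
    rw [derivative_pow, lin_deriv]
    cases h with
    | zero => simp
    | succ h => simp; ring
  have dinv : ∀ d : ℝ, d ≠ 0 → derivative ℝ ((lin d)⁻¹^n) = - C (n:ℝ) * (lin d)⁻¹^(n+1) := by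
    intro d hd
    rw [derivative_pow, derivative_inv', lin_deriv]
    cases n with
    | zero => simp
    | succ n => simp; ring
  have hXAB : X * lin d1 * lin d2 = lin a * (lin a^2 - 5 * lin a + 4) := by
    have e1' : (C d1 : PowerSeries ℝ) + C d2 = 3 * C a - 5 := by
      have := congrArg (C : ℝ →+* PowerSeries ℝ) e1
      simpa [map_ofNat (C : ℝ →+* PowerSeries ℝ)] using this
    have e2' : (C d1 : PowerSeries ℝ) * C d2 = 3 * C a^2 - 10 * C a + 4 := by
      have := congrArg (C : ℝ →+* PowerSeries ℝ) e2
      simpa [map_ofNat (C : ℝ →+* PowerSeries ℝ)] using this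
    have e3' : (C a : PowerSeries ℝ)^3 - 5 * C a^2 + 4 * C a = 0 := by
      have := congrArg (C : ℝ →+* PowerSeries ℝ) e3
      simpa [map_ofNat (C : ℝ →+* PowerSeries ℝ)] using this
    simp only [lin]
    linear_combination X^2 * e1' + X * e2' - e3'
  have hsum : X * lin d1 + X * lin d2 + lin d1 * lin d2 = 3 * lin a^2 - 10 * lin a + 4 := by
    have e1' : (C d1 : PowerSeries ℝ) + C d2 = 3 * C a - 5 := by
      have := congrArg (C : ℝ →+* PowerSeries ℝ) e1
      simpa [map_ofNat (C : ℝ →+* PowerSeries ℝ)] using this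
    have e2' : (C d1 : PowerSeries ℝ) * C d2 = 3 * C a^2 - 10 * C a + 4 := by
      have := congrArg (C : ℝ →+* PowerSeries ℝ) e2
      simpa [map_ofNat (C : ℝ →+* PowerSeries ℝ)] using this
    simp only [lin]
    linear_combination 2 * X * e1' + e2'
  have hE : lin (N+a) = C N + lin a := by simp [lin]; ring
  rw [deriv_mul', deriv_mul', deriv_mul', deriv_mul', dinv d1 h1, dinv d2 h2, lin_deriv]
  have q3 : (C (qc3 n h) : PowerSeries ℝ) = C (h:ℝ) - 2 * C (n:ℝ) + C (3/2) := by
    simp [qc3, map_ofNat (C : ℝ →+* PowerSeries ℝ)]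
  have q2 : (C (qc2 n h N) : PowerSeries ℝ) = -5*(C (n:ℝ)+C (3/2)) - 5*C (h:ℝ) + 10*C (n:ℝ) + C N*(C (h:ℝ)-3*C (n:ℝ)) := by
    simp [qc2, map_ofNat (C : ℝ →+* PowerSeries ℝ)]
  have q1 : (C (qc1 n h N) : PowerSeries ℝ) = 4*(C (n:ℝ)+C (3/2)) + 4*C (h:ℝ) - 4*C (n:ℝ) + C N*(-5*C (h:ℝ)+10*C (n:ℝ)) := by
    simp [qc1, map_ofNat (C : ℝ →+* PowerSeries ℝ)]
  have q0 : (C (qc0 n h N) : PowerSeries ℝ) = C N*(4*C (h:ℝ)-4*C (n:ℝ)) := by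
    simp [qc0, map_ofNat (C : ℝ →+* PowerSeries ℝ)]
  have q32 : (C (3/2 : ℝ) : PowerSeries ℝ) = C (1/2) + 1 := by
    rw [← map_one (C : ℝ →+* PowerSeries ℝ), ← map_add]; norm_num
  have hGC : lin (N+a) * derivative ℝ (Gs n (N+a)) = (C (n:ℝ) + C (1/2)) * Gs n (N+a) := by
    rw [hG, map_add]
  rw [q3, q2, q1, q0, q32]
  rw [hGC]
  rw [hE]
  generalize derivative ℝ (lin a ^ h) = DZ at *
  generalize (lin d1)⁻¹ = Ai at *
  generalize (lin d2)⁻¹ = Bi at *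
  generalize Gs n (N+a) = G at *
  generalize lin a = Z at *
  generalize lin d1 = A at *
  generalize lin d2 = B at *
  generalize (C (1/2 : ℝ) : PowerSeries ℝ) = hf at *
  generalize (C (n : ℝ) : PowerSeries ℝ) = nn at *
  generalize (C (h : ℝ) : PowerSeries ℝ) = hh at *
  generalize (C N : PowerSeries ℝ) = NN at *
  have s1 : Ai^n * Bi^n = Ai^(n+1) * Bi^(n+1) * (A*B) := by
    linear_combination (-Ai^n * Bi^n * B * Bi) * hA - Ai^n * Bi^n * hB
  have s2 : Ai^n * Bi^(n+1) = Ai^(n+1) * Bi^(n+1) * A := by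
    linear_combination (-Ai^n * Bi^(n+1)) * hA
  have s3 : Ai^(n+1) * Bi^n = Ai^(n+1) * Bi^(n+1) * B := by
    linear_combination (-Ai^(n+1) * Bi^n) * hB
  have s4 : X * DZ * (Ai^n * Bi^n) = hh * Z^h * (Z^2 - 5*Z + 4) * (Ai^(n+1) * Bi^(n+1)) := by
    rw [s1]
    linear_combination (DZ * Ai^(n+1) * Bi^(n+1)) * hXAB + (Z^2 - 5*Z + 4) * (Ai^(n+1) * Bi^(n+1)) * hZ
  linear_combination (-(NN + Z) * G) * s4
   + (-X * Z^h * G * (nn + hf + 1) + nn * Z^h * (NN+Z) * G) * s1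
   + (nn * X * Z^h * (NN+Z) * G) * s2 + (nn * X * Z^h * (NN+Z) * G) * s3
   - (Z^h * G * (nn+hf+1) * Ai^(n+1) * Bi^(n+1)) * hXAB
   + (nn * Z^h * (NN+Z) * G * Ai^(n+1) * Bi^(n+1)) * hsum

/-- the weights -/
noncomputable def vG (n : ℕ) (N : ℝ) (v : Fin 3 → ℝ) : Fin 3 → PowerSeries ℝ :=
  fun j => PowerSeries.C (v j) * Gs n (N + nd j)

lemma Lam_rec (n h : ℕ) (N : ℝ) (hN : 0 < N) (v : Fin 3 → ℝ) :
    qc3 n h * Lam (fun _ => n+1) (zg^(h+3) * vG n N v) + qc2 n h N * Lam (fun _ => n+1) (zg^(h+2) * vG n N v)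
    + qc1 n h N * Lam (fun _ => n+1) (zg^(h+1) * vG n N v) + qc0 n h N * Lam (fun _ => n+1) (zg^h * vG n N v) = 0 := by
  rw [← Lam_smul, ← Lam_smul, ← Lam_smul, ← Lam_smul, ← Lam_add, ← Lam_add, ← Lam_add]
  unfold Lam
  apply Finset.sum_eq_zero
  intro j _
  rw [if_neg (by simp)]
  have key : ∀ (a d1 d2 vv : ℝ) (h1 : d1 ≠ 0) (h2 : d2 ≠ 0) (hM : N + a ≠ 0)
    (e1 : d1 + d2 = 3*a - 5) (e2 : d1*d2 = 3*a^2 - 10*a + 4) (e3 : a^3 - 5*a^2 + 4*a = 0),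
     PowerSeries.coeff n ((qc3 n h • (lin a^(h+3) * (PowerSeries.C vv * Gs n (N+a))) + qc2 n h N • (lin a^(h+2) * (PowerSeries.C vv * Gs n (N+a)))
       + qc1 n h N • (lin a^(h+1) * (PowerSeries.C vv * Gs n (N+a))) + qc0 n h N • (lin a^h * (PowerSeries.C vv * Gs n (N+a)))) *
       ((lin d1)⁻¹^(n+1) * (lin d2)⁻¹^(n+1))) = 0 := by
    intro a d1 d2 vv h1 h2 hM e1 e2 e3
    have := node_rec n h N a d1 d2 h1 h2 hM e1 e2 e3
    rw [← mul_zero vv, ← this, ← PowerSeries.coeff_C_mul]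
    congr 1
    simp only [PowerSeries.smul_eq_C_mul]
    ring
  have b0 : Bser (fun _ => n+1) 0 = (lin (0-1))⁻¹^(n+1) * (lin (0-4))⁻¹^(n+1) := by
    unfold Bser
    rw [show (Finset.univ.erase (0: Fin 3)) = {1,2} by decide, Finset.prod_pair (by decide)]
    simp [nd]
  have b1 : Bser (fun _ => n+1) 1 = (lin (1-0))⁻¹^(n+1) * (lin (1-4))⁻¹^(n+1) := by
    unfold Bser
    rw [show (Finset.univ.erase (1: Fin 3)) = {0,2} by decide, Finset.prod_pair (by decide)]
    simp [nd]
  have b2 : Bser (fun _ => n+1) 2 = (lin (4-0))⁻¹^(n+1) * (lin (4-1))⁻¹^(n+1) := by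
    unfold Bser
    rw [show (Finset.univ.erase (2: Fin 3)) = {0,1} by decide, Finset.prod_pair (by decide)]
    simp [nd]
  fin_cases j
  · have := key 0 (0-1) (0-4) (v 0) (by norm_num) (by norm_num) (by positivity) (by norm_num) (by norm_num) (by norm_num)
    rw [← b0] at this
    exact this
  · have := key 1 (1-0) (1-4) (v 1) (by norm_num) (by norm_num) (by positivity) (by norm_num) (by norm_num) (by norm_num)
    rw [← b1] at this
    exact this
  · have := key 4 (4-0) (4-1) (v 2) (by norm_num) (by norm_num) (by positivity) (by norm_num) (by norm_num) (by norm_num)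
    rw [← b2] at this
    exact this

lemma nonvanish (n : ℕ) (N : ℝ) (hN : 0 < N) (v : Fin 3 → ℝ) (hv : v 0 ≠ 0) :
    ∃ i < 3, Lam (fun _ => n+1) (zg^i * vG n N v) ≠ 0 := by
  by_contra! hcon
  have all : ∀ q, Lam (fun _ => n+1) (zg^q * vG n N v) = 0 := by
    intro q
    induction q using Nat.strong_induction_on with
    | _ q ih =>
      rcases Nat.lt_or_ge q 3 with hq | hq
      · exact hcon q hq
      · obtain ⟨h, rfl⟩ : ∃ t, q = t + 3 := ⟨q - 3, by omega⟩
        have := Lam_rec n h N hN v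
        rw [ih (h+2) (by omega), ih (h+1) (by omega), ih h (by omega)] at this
        have q3 : qc3 n h ≠ 0 := by
          unfold qc3
          intro h0
          have : (2 * (h:ℝ) + 3) = 4*n := by linarith
          have : 2*h+3 = 4*n := by exact_mod_cast this
          omega
        simpa [q3] using this
  have := Lam_vanish (vG n N v) (3*n+2) (fun _ => n+1) (by simp; ring) (by simp) all
  simp [vG, Gs, nd, hv] at this
  exact absurd this.1 hN.ne'


lemma rc_half (r : ℕ) : Ring.choose (-1/2 : ℝ) r * 4^r = (-1)^r * (Nat.centralBinom r : ℝ) := by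
  induction r with
  | zero => simp
  | succ r ih =>
    have h := rc_rec (-1/2) r
    have h2 := Nat.succ_mul_centralBinom_succ r
    have h3 : ((r:ℝ)+1) * (Nat.centralBinom (r+1) : ℝ) = 2 * (2*r+1) * (Nat.centralBinom r : ℝ) := by
      exact_mod_cast h2
    have hr : (r:ℝ)+1 ≠ 0 := by positivity
    apply mul_left_cancel₀ hr
    rw [pow_succ, pow_succ]
    linear_combination (4 * 4^r) * h + 4 * (-1/2 - r) * ih + (-1)^r * h3

lemma rc_int (n r : ℕ) : ∃ c : ℤ, Ring.choose ((n:ℝ)+1/2) r * 4^r = c := by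
  have key : ∀ n r : ℕ, ∃ c : ℤ, Ring.choose ((n:ℝ)-1/2) r * 4^r = c := by
    intro n
    induction n with
    | zero =>
      intro r
      refine ⟨(-1)^r * Nat.centralBinom r, ?_⟩
      have := rc_half r
      push_cast
      rw [← this]; norm_num
    | succ n ih =>
      intro r
      cases r with
      | zero => exact ⟨1, by simp⟩
      | succ r =>
        obtain ⟨c1, h1⟩ := ih r
        obtain ⟨c2, h2⟩ := ih (r+1)
        refine ⟨4*c1 + c2, ?_⟩
        have := Ring.choose_succ_succ ((n:ℝ)-1/2) r
        rw [show ((n:ℝ)-1/2) + 1 = ((n+1:ℕ):ℝ)-1/2 by push_cast; ring] at this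
        rw [this]
        push_cast
        rw [← h1, ← h2]; ring
  obtain ⟨c, h⟩ := key (n+1) r
  refine ⟨c, ?_⟩
  rw [← h]; push_cast; ring_nf

/-- integrality of scaled coefficients -/
def IntUp (n : ℕ) (e : ℝ) (F : PowerSeries ℝ) : Prop :=
  ∀ m ≤ n, ∃ c : ℤ, e * 12^m * PowerSeries.coeff m F = c

lemma IntUp_Gs (n : ℕ) (M : ℤ) (hM : 0 < M) : IntUp n 1 (Gs n M) := by
  intro m hm
  obtain ⟨c, hc⟩ := rc_int n m
  refine ⟨3^m * c * M^(n-m), ?_⟩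
  have hM' : (M:ℝ) ≠ 0 := by exact_mod_cast hM.ne'
  simp only [Gs, PowerSeries.coeff_mk]
  push_cast
  rw [← hc, show (12:ℝ) = 3*4 by norm_num, mul_pow, inv_pow]
  have : (M:ℝ)^n = (M:ℝ)^(n-m) * (M:ℝ)^m := by rw [← pow_add]; congr 1; omega
  rw [this]; field_simp

lemma IntUp_lin (n : ℕ) (e : ℝ) (F : PowerSeries ℝ) (a : ℤ) (h : IntUp n e F) :
    IntUp n e (lin a * F) := by
  intro m hm
  cases m with
  | zero =>
    obtain ⟨c, hc⟩ := h 0 hm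
    exact ⟨a*c, by rw [coeff_lin_mul_zero]; push_cast; rw [← hc]; ring⟩
  | succ m =>
    obtain ⟨c, hc⟩ := h (m+1) hm
    obtain ⟨c', hc'⟩ := h m (by omega)
    exact ⟨a*c+12*c', by rw [coeff_lin_mul]; push_cast; rw [← hc, ← hc']; ring⟩

lemma IntUp_inv (n : ℕ) (e : ℝ) (F : PowerSeries ℝ) (d d' : ℤ) (hd : d * d' = 12) (h : IntUp n e F) :
    IntUp n (e*d) ((lin d)⁻¹ * F) := by
  have hd0 : (d:ℝ) ≠ 0 := by
    intro h0
    have : d = 0 := by exact_mod_cast h0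
    subst this; simp at hd
  have hF : lin d * ((lin d)⁻¹ * F) = F := by rw [← mul_assoc, lin_mul_inv hd0, one_mul]
  have hdr : (d:ℝ) * d' = 12 := by exact_mod_cast hd
  intro m
  generalize (lin (d:ℝ))⁻¹ * F = H at *
  induction m with
  | zero =>
    intro hm
    obtain ⟨c, hc⟩ := h 0 hm
    refine ⟨c, ?_⟩
    rw [← hc, ← hF, coeff_lin_mul_zero]; ring
  | succ m ih =>
    intro hm
    obtain ⟨c, hc⟩ := h (m+1) hm
    obtain ⟨c', hc'⟩ := ih (by omega)
    refine ⟨c - d' * c', ?_⟩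
    push_cast
    rw [← hc, ← hc', ← hF, coeff_lin_mul, pow_succ]
    linear_combination (e * 12^m * PowerSeries.coeff m H) * hdr

lemma IntUp_lin_pow (n : ℕ) (e : ℝ) (F : PowerSeries ℝ) (a : ℤ) (h : IntUp n e F) (i : ℕ) :
    IntUp n e (lin a^i * F) := by
  induction i with
  | zero => simpa
  | succ i ih =>
    rw [pow_succ', mul_assoc]; exact IntUp_lin n e _ a ih

lemma IntUp_inv_pow (n : ℕ) (e : ℝ) (F : PowerSeries ℝ) (d d' : ℤ) (hd : d * d' = 12) (h : IntUp n e F) (i : ℕ) :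
    IntUp n (e*d^i) ((lin d)⁻¹^i * F) := by
  induction i with
  | zero => simpa
  | succ i ih =>
    rw [pow_succ' (lin (d:ℝ))⁻¹, mul_assoc, pow_succ (d:ℝ), ← mul_assoc]; exact IntUp_inv n _ _ d d' hd ih

lemma node_int (n i : ℕ) (M a d1 d2 d1' d2' t : ℤ) (hM : 0 < M) (h1 : d1*d1' = 12) (h2 : d2*d2' = 12)
    (ht : d1*d2*t = 12) (v : ℤ) :
    ∃ c : ℤ, 12*144^n * PowerSeries.coeff n (lin a^i * (PowerSeries.C (v:ℝ) * Gs n M) *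
      ((lin d1)⁻¹^(n+1) * (lin d2)⁻¹^(n+1))) = c := by
  have h := IntUp_inv_pow n _ _ d2 d2' h2 (IntUp_inv_pow n _ _ d1 d1' h1 (IntUp_lin_pow n _ _ a (IntUp_Gs n M hM) i) (n+1)) (n+1)
  obtain ⟨c, hc⟩ := h n le_rfl
  refine ⟨t^(n+1) * v * c, ?_⟩
  push_cast
  rw [← hc]
  have e : lin (a:ℝ)^i * (PowerSeries.C (v:ℝ) * Gs n M) * ((lin (d1:ℝ))⁻¹^(n+1) * (lin (d2:ℝ))⁻¹^(n+1))
    = PowerSeries.C (v:ℝ) * ((lin (d2:ℝ))⁻¹^(n+1) * ((lin (d1:ℝ))⁻¹^(n+1) * (lin (a:ℝ)^i * Gs n M))) := by ring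
  rw [e, PowerSeries.coeff_C_mul]
  have ht' : (d1:ℝ)*d2*t = 12 := by exact_mod_cast ht
  have : (12:ℝ)*144^n = ((d1:ℝ)*d2*t)^(n+1) * 12^n := by
    rw [ht', pow_succ, show (144:ℝ) = 12*12 by norm_num, mul_pow]; ring
  rw [this, mul_pow, mul_pow]; ring

lemma Bser0 (n : ℕ) : Bser (fun _ => n+1) 0 = (lin (-1))⁻¹^(n+1) * (lin (-4))⁻¹^(n+1) := by
  unfold Bser
  rw [show (Finset.univ.erase (0: Fin 3)) = {1,2} by decide, Finset.prod_pair (by decide)]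
  simp [nd]
lemma Bser1 (n : ℕ) : Bser (fun _ => n+1) 1 = (lin 1)⁻¹^(n+1) * (lin (-3))⁻¹^(n+1) := by
  unfold Bser
  rw [show (Finset.univ.erase (1: Fin 3)) = {0,2} by decide, Finset.prod_pair (by decide)]
  simp [nd]; norm_num
lemma Bser2 (n : ℕ) : Bser (fun _ => n+1) 2 = (lin 4)⁻¹^(n+1) * (lin 3)⁻¹^(n+1) := by
  unfold Bser
  rw [show (Finset.univ.erase (2: Fin 3)) = {0,1} by decide, Finset.prod_pair (by decide)]
  simp [nd]; norm_num

/-- the coefficients `p_{ij}` -/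
noncomputable def pp (n i : ℕ) (N : ℝ) (j : Fin 3) : ℝ :=
  PowerSeries.coeff n (zg j^i * Gs n (N + nd j) * Bser (fun _ => n+1) j)

lemma Lam_eq_pp (n i : ℕ) (N : ℝ) (v : Fin 3 → ℝ) :
    Lam (fun _ => n+1) (zg^i * vG n N v) = ∑ j, v j * pp n i N j := by
  unfold Lam pp
  refine Finset.sum_congr rfl fun j _ => ?_
  rw [if_neg (by simp), ← PowerSeries.coeff_C_mul]
  simp only [Pi.mul_apply, Pi.pow_apply, vG, Nat.add_sub_cancel]
  congr 1; ring

lemma pp_int (n i : ℕ) (N : ℤ) (hN : 0 < N) (v : Fin 3 → ℤ) (j : Fin 3) :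
    ∃ c : ℤ, 12*144^n * (v j * pp n i N j) = c := by
  unfold pp
  rw [← PowerSeries.coeff_C_mul]
  fin_cases j
  · obtain ⟨c, hc⟩ := node_int n i N 0 (-1) (-4) (-12) (-3) 3 hN (by norm_num) (by norm_num) (by norm_num) (v 0)
    refine ⟨c, ?_⟩
    rw [← hc]
    show _ * PowerSeries.coeff n (PowerSeries.C (v 0:ℝ) * (zg 0^i * Gs n (N + nd 0) * Bser (fun _ => n+1) 0)) = _
    rw [Bser0]
    simp only [zg, nd, Matrix.cons_val_zero]
    push_cast
    rw [add_zero]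
    congr 2; ring
  · obtain ⟨c, hc⟩ := node_int n i (N+1) 1 1 (-3) 12 (-4) (-4) (by omega) (by norm_num) (by norm_num) (by norm_num) (v 1)
    refine ⟨c, ?_⟩
    rw [← hc]
    show _ * PowerSeries.coeff n (PowerSeries.C (v 1:ℝ) * (zg 1^i * Gs n (N + nd 1) * Bser (fun _ => n+1) 1)) = _
    rw [Bser1]
    simp only [zg, nd, Matrix.cons_val_one, Matrix.cons_val_zero]
    push_cast
    congr 2; ring
  · obtain ⟨c, hc⟩ := node_int n i (N+4) 4 4 3 3 4 1 (by omega) (by norm_num) (by norm_num) (by norm_num) (v 2)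
    refine ⟨c, ?_⟩
    rw [← hc]
    show _ * PowerSeries.coeff n (PowerSeries.C (v 2:ℝ) * (zg 2^i * Gs n (N + nd 2) * Bser (fun _ => n+1) 2)) = _
    rw [Bser2]
    simp only [zg, nd, Matrix.cons_val]
    push_cast
    congr 2; ring

lemma Lam_int (n i : ℕ) (N : ℤ) (hN : 0 < N) (v : Fin 3 → ℤ) :
    ∃ c : ℤ, 12*144^n * Lam (fun _ => n+1) (zg^i * vG n N (fun j => (v j:ℝ))) = c := by
  rw [Lam_eq_pp, Fin.sum_univ_three]
  obtain ⟨c0, h0⟩ := pp_int n i N hN v 0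
  obtain ⟨c1, h1⟩ := pp_int n i N hN v 1
  obtain ⟨c2, h2⟩ := pp_int n i N hN v 2
  exact ⟨c0+c1+c2, by push_cast; rw [← h0, ← h1, ← h2]; ring⟩

/-! bounds -/
lemma rc_bound1 (n r : ℕ) (hr : r ≤ n+1) :
    0 ≤ Ring.choose ((n:ℝ)+1/2) r ∧ Ring.choose ((n:ℝ)+1/2) r ≤ ((n+1).choose r : ℝ) := by
  induction r with
  | zero => simp
  | succ r ih =>
    obtain ⟨i1, i2⟩ := ih (by omega)
    have h := rc_rec ((n:ℝ)+1/2) r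
    have h2 := Nat.choose_succ_right_eq (n+1) r
    have h3 : ((n+1).choose (r+1) : ℝ) * (r+1) = ((n+1).choose r : ℝ) * (n+1-r) := by
      have : (((n+1) - r : ℕ) : ℝ) = n+1-r := by
        rw [Nat.cast_sub (by omega)]; push_cast; ring
      rw [← this]
      exact_mod_cast h2
    have hrn : (r:ℝ) ≤ n := by exact_mod_cast (by omega : r ≤ n)
    have hr0 : (0:ℝ) < r+1 := by positivity
    constructor
    · by_contra! hc
      have := mul_neg_of_neg_of_pos hc hr0
      have : 0 ≤ Ring.choose ((n:ℝ)+1/2) r * (n+1/2-r) := mul_nonneg i1 (by linarith)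
      linarith
    · refine le_of_mul_le_mul_right ?_ hr0
      rw [h, h3]
      exact mul_le_mul i2 (by linarith) (by linarith) (by positivity)

lemma rc_bound2 (n r : ℕ) (hr : n+1 ≤ r) : |Ring.choose ((n:ℝ)+1/2) r| ≤ 1 := by
  induction r, hr using Nat.le_induction with
  | base =>
    obtain ⟨h1, h2⟩ := rc_bound1 n (n+1) le_rfl
    rw [abs_of_nonneg h1]; simpa using h2
  | succ r hr ih =>
    have h := congrArg abs (rc_rec ((n:ℝ)+1/2) r)
    rw [abs_mul, abs_mul] at h
    have hrn : (n:ℝ)+1 ≤ r := by exact_mod_cast hr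
    have hr0 : (0:ℝ) < r+1 := by positivity
    rw [abs_of_pos hr0, abs_of_neg (by linarith : (n:ℝ)+1/2-r < 0)] at h
    refine le_of_mul_le_mul_right ?_ hr0
    rw [h]
    have hn : (0:ℝ) ≤ n := by positivity
    exact mul_le_mul ih (by linarith) (by linarith) (by norm_num)

def Bd (n : ℕ) (ρ K : ℝ) (F : PowerSeries ℝ) : Prop := ∀ m ≤ n, |PowerSeries.coeff m F| * ρ^m ≤ K

lemma Bd_Gs (n : ℕ) (ρ M : ℝ) (h0 : 0 ≤ ρ) (h1 : ρ ≤ 1) (hM : 1 ≤ M) : Bd n ρ (2^(n+1)*M^n) (Gs n M) := by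
  intro m hm
  simp only [Gs, PowerSeries.coeff_mk]
  obtain ⟨b1, b2⟩ := rc_bound1 n m (by omega)
  have hM0 : 0 < M := by linarith
  rw [abs_mul, abs_of_nonneg b1, abs_of_nonneg (by positivity)]
  have b3 : Ring.choose ((n:ℝ)+1/2) m ≤ 2^(n+1) := b2.trans (by exact_mod_cast Nat.choose_le_two_pow (n+1) m)
  have b4 : (M⁻¹)^m ≤ 1 := pow_le_one₀ (by positivity) (inv_le_one_of_one_le₀ hM)
  have b5 : ρ^m ≤ 1 := pow_le_one₀ h0 h1
  calc Ring.choose ((n:ℝ)+1/2) m * (M^n * (M⁻¹)^m) * ρ^m ≤ 2^(n+1) * (M^n * 1) * 1 := by gcongr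
    _ = _ := by ring

lemma Bd_lin (n : ℕ) (ρ K a : ℝ) (F : PowerSeries ℝ) (h0 : 0 ≤ ρ) (h : Bd n ρ K F) :
    Bd n ρ (K*(|a|+ρ)) (lin a * F) := by
  have hK : 0 ≤ K := le_trans (by positivity) (h 0 (by omega))
  intro m hm
  cases m with
  | zero =>
    have := h 0 hm
    rw [coeff_lin_mul_zero, abs_mul]
    simp only [pow_zero, mul_one] at this ⊢
    nlinarith [abs_nonneg a, mul_le_mul_of_nonneg_left this (abs_nonneg a), mul_nonneg hK h0]
  | succ m =>
    have t1 := h (m+1) hm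
    have t2 := h m (by omega)
    rw [coeff_lin_mul]
    calc _ ≤ (|a| * |PowerSeries.coeff (m+1) F| + |PowerSeries.coeff m F|) * ρ^(m+1) := by
          gcongr
          refine (abs_add_le _ _).trans ?_
          rw [abs_mul]
      _ = |a| * (|PowerSeries.coeff (m+1) F| * ρ^(m+1)) + ρ * (|PowerSeries.coeff m F| * ρ^m) := by ring
      _ ≤ |a| * K + ρ * K := by gcongr
      _ = _ := by ring

lemma Bd_inv (n : ℕ) (ρ K d : ℝ) (F : PowerSeries ℝ) (h0 : 0 ≤ ρ) (hd : ρ < |d|) (h : Bd n ρ K F) :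
    Bd n ρ (K/(|d|-ρ)) ((lin d)⁻¹ * F) := by
  have hK : 0 ≤ K := le_trans (by positivity) (h 0 (by omega))
  have hd0 : d ≠ 0 := by
    rintro rfl; simp at hd; linarith
  have hF : lin d * ((lin d)⁻¹ * F) = F := by rw [← mul_assoc, lin_mul_inv hd0, one_mul]
  intro m
  generalize (lin d)⁻¹ * F = H at *
  have hpos : 0 < |d| - ρ := by linarith
  have hdp : 0 < |d| := by linarith
  induction m with
  | zero =>
    intro hm
    have t := h 0 hm
    rw [← hF, coeff_lin_mul_zero, abs_mul] at t
    rw [le_div_iff₀ hpos]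
    simp only [pow_zero, mul_one] at t ⊢
    nlinarith [abs_nonneg (PowerSeries.coeff 0 H)]
  | succ m ih =>
    intro hm
    have t := h (m+1) hm
    have t2 := ih (by omega)
    rw [← hF, coeff_lin_mul] at t
    have t3 : |d| * |PowerSeries.coeff (m+1) H| ≤ |d * PowerSeries.coeff (m+1) H + PowerSeries.coeff m H| + |PowerSeries.coeff m H| := by
      rw [← abs_mul]
      have := abs_sub (d * PowerSeries.coeff (m+1) H + PowerSeries.coeff m H) (PowerSeries.coeff m H)
      simpa using this
    refine le_of_mul_le_mul_left ?_ hdp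
    calc |d| * (|PowerSeries.coeff (m+1) H| * ρ^(m+1)) = (|d| * |PowerSeries.coeff (m+1) H|) * ρ^(m+1) := by ring
      _ ≤ (|d * PowerSeries.coeff (m+1) H + PowerSeries.coeff m H| + |PowerSeries.coeff m H|) * ρ^(m+1) := by gcongr
      _ = |d * PowerSeries.coeff (m+1) H + PowerSeries.coeff m H| * ρ^(m+1) + ρ * (|PowerSeries.coeff m H| * ρ^m) := by ring
      _ ≤ K + ρ * (K/(|d|-ρ)) := by gcongr
      _ = |d| * (K/(|d|-ρ)) := by field_simp; ring

lemma Bd_lin_pow (n : ℕ) (ρ K a : ℝ) (F : PowerSeries ℝ) (h0 : 0 ≤ ρ) (h : Bd n ρ K F) (i : ℕ) :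
    Bd n ρ (K*(|a|+ρ)^i) (lin a^i * F) := by
  induction i with
  | zero => simpa
  | succ i ih =>
    rw [pow_succ' (lin a), mul_assoc, pow_succ (|a|+ρ), ← mul_assoc]; exact Bd_lin n ρ _ a _ h0 ih

lemma Bd_inv_pow (n : ℕ) (ρ K d : ℝ) (F : PowerSeries ℝ) (h0 : 0 ≤ ρ) (hd : ρ < |d|) (h : Bd n ρ K F) (i : ℕ) :
    Bd n ρ (K/(|d|-ρ)^i) ((lin d)⁻¹^i * F) := by
  induction i with
  | zero => simpa
  | succ i ih =>
    rw [pow_succ' (lin d)⁻¹, mul_assoc, pow_succ (|d|-ρ), ← div_div]; exact Bd_inv n ρ _ d _ h0 hd ih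

lemma pp_bound1 (n i : ℕ) (hi : i < 3) (N : ℝ) (hN : 0 < N) : |pp n i N 1| ≤ 3.6*(3.2*(N+1))^n := by
  have h := Bd_inv_pow n _ _ (-3) _ (by norm_num) (by norm_num) (Bd_inv_pow n _ _ 1 _ (by norm_num) (by norm_num)
    (Bd_lin_pow n _ _ 1 _ (by norm_num) (Bd_Gs n (1/2) (N+1) (by norm_num) (by norm_num) (by linarith)) i) (n+1)) (n+1)
  have := h n le_rfl
  unfold pp
  rw [Bser1]
  simp only [zg, nd, Matrix.cons_val_one, Matrix.cons_val_zero]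
  rw [show lin 1^i * Gs n (N+1) * ((lin 1)⁻¹^(n+1) * (lin (-3))⁻¹^(n+1)) =
    (lin (-3))⁻¹^(n+1) * ((lin 1)⁻¹^(n+1) * (lin 1^i * Gs n (N+1))) by ring]
  generalize |PowerSeries.coeff n ((lin (-3))⁻¹^(n+1) * ((lin 1)⁻¹^(n+1) * (lin 1^i * Gs n (N+1))))| = c at *
  have hb : (|(1:ℝ)|+1/2)^i ≤ 9/4 := by
    interval_cases i <;> norm_num
  have e : c = (c * (1/2)^n) * 2^n := by
    rw [mul_assoc, ← mul_pow]; norm_num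
  rw [e]
  calc _ ≤ _ := mul_le_mul_of_nonneg_right this (by positivity)
    _ ≤ (2^(n+1)*(N+1)^n*(9/4)/(|(1:ℝ)|-1/2)^(n+1)/(|(-3:ℝ)|-1/2)^(n+1)) * 2^n := by
        have h1 : (0:ℝ) < |(1:ℝ)|-1/2 := by norm_num
        have h2 : (0:ℝ) < |(-3:ℝ)|-1/2 := by norm_num
        gcongr
    _ = 3.6*(3.2*(N+1))^n := by
        rw [show |(1:ℝ)|-1/2 = 1/2 by norm_num, show |(-3:ℝ)|-1/2 = 5/2 by norm_num]
        rw [div_div, ← mul_pow, mul_pow 3.2, show (3.2:ℝ) = 2*2/(1/2*(5/2)) by norm_num, div_pow, mul_pow 2 2]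
        rw [pow_succ, pow_succ]
        field_simp
        norm_num

lemma pp_bound2 (n i : ℕ) (hi : i < 3) (N : ℝ) (hN : 0 < N) : |pp n i N 2| ≤ 9*((N+4)/3)^n := by
  have h := Bd_inv_pow n _ _ 3 _ (by norm_num) (by norm_num) (Bd_inv_pow n _ _ 4 _ (by norm_num) (by norm_num)
    (Bd_lin_pow n _ _ 4 _ (by norm_num) (Bd_Gs n 1 (N+4) (by norm_num) (by norm_num) (by linarith)) i) (n+1)) (n+1)
  have := h n le_rfl
  unfold pp
  rw [Bser2]
  simp only [zg, nd, Matrix.cons_val]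
  rw [show lin 4^i * Gs n (N+4) * ((lin 4)⁻¹^(n+1) * (lin 3)⁻¹^(n+1)) =
    (lin 3)⁻¹^(n+1) * ((lin 4)⁻¹^(n+1) * (lin 4^i * Gs n (N+4))) by ring]
  generalize |PowerSeries.coeff n ((lin 3)⁻¹^(n+1) * ((lin 4)⁻¹^(n+1) * (lin 4^i * Gs n (N+4))))| = c at *
  have hb : (|(4:ℝ)|+1)^i ≤ 25 := by
    interval_cases i <;> norm_num
  rw [one_pow, mul_one] at this
  calc c ≤ _ := this
    _ ≤ (2^(n+1)*(N+4)^n*25/(|(4:ℝ)|-1)^(n+1)/(|(3:ℝ)|-1)^(n+1)) := by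
        have h1 : (0:ℝ) < |(4:ℝ)|-1 := by norm_num
        have h2 : (0:ℝ) < |(3:ℝ)|-1 := by norm_num
        gcongr
    _ = 25/3*((N+4)/3)^n := by
        rw [show |(4:ℝ)|-1 = 3 by norm_num, show |(3:ℝ)|-1 = 2 by norm_num, div_pow]
        field_simp
        ring
    _ ≤ _ := by
        have : 0 ≤ ((N+4)/3)^n := by positivity
        linarith


lemma rc_hasSum (s x : ℝ) (hx : |x| < 1) : HasSum (fun t => Ring.choose s t * x^t) ((1+x)^s) := by
  have h := (Real.one_add_rpow_hasFPowerSeriesOnBall_zero (a := s)).hasSum (y := x) (by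
    simp [enorm, ← NNReal.coe_lt_coe, hx])
  simpa [binomialSeries, FormalMultilinearSeries.ofScalars_apply_eq, smul_eq_mul, mul_comm] using h

lemma coeff_lin_pow (a : ℝ) (h r : ℕ) :
    PowerSeries.coeff r (lin a^h) = a^(h-r) * (h.choose r : ℝ) := by
  rw [← Polynomial.coeff_X_add_C_pow, ← Polynomial.coeff_coe]
  congr 1
  simp [lin, add_comm]

lemma germ_hasSum (n r : ℕ) (N a : ℝ) (hN : 4 < N) (ha : 0 ≤ a) (ha4 : a ≤ 4) :
    HasSum (fun h => (Ring.choose ((n:ℝ)+1/2) h * (Real.sqrt N * N^n * (N⁻¹)^h)) * PowerSeries.coeff r (lin a^h))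
      (Real.sqrt (N+a) * PowerSeries.coeff r (Gs n (N+a))) := by
  have hN0 : 0 < N := by linarith
  have hM0 : 0 < N + a := by linarith
  have hx : |a/N| < 1 := by
    rw [abs_of_nonneg (by positivity), div_lt_one hN0]; linarith
  have h1 := (rc_hasSum ((n:ℝ)+1/2-r) (a/N) hx).mul_left
    (Ring.choose ((n:ℝ)+1/2) r * (Real.sqrt N * N^n * (N⁻¹)^r))
  have e1 : (1 + a/N) = (N+a)/N := by field_simp
  have e2 : (1 + a/N)^((n:ℝ)+1/2-r) = (N+a)^n / N^n * (Real.sqrt (N+a) / Real.sqrt N) / ((N+a)^r/N^r) := by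
    rw [e1, Real.rpow_sub (by positivity), Real.rpow_add (by positivity), Real.rpow_natCast, Real.rpow_natCast,
      ← Real.sqrt_eq_rpow, Real.sqrt_div (by positivity), div_pow, div_pow]
  have hs : Real.sqrt N ≠ 0 := (Real.sqrt_pos.mpr hN0).ne'
  have e3 : Ring.choose ((n:ℝ)+1/2) r * (Real.sqrt N * N^n * (N⁻¹)^r) * (1 + a/N)^((n:ℝ)+1/2-r)
      = Real.sqrt (N+a) * PowerSeries.coeff r (Gs n (N+a)) := by
    rw [e2]
    simp only [Gs, PowerSeries.coeff_mk, inv_pow]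
    field_simp
  rw [e3] at h1
  have h2 : HasSum (fun t => (fun h => (Ring.choose ((n:ℝ)+1/2) h * (Real.sqrt N * N^n * (N⁻¹)^h)) * PowerSeries.coeff r (lin a^h)) (t + r))
      (Real.sqrt (N+a) * PowerSeries.coeff r (Gs n (N+a))) := by
    refine h1.congr_fun ?_ |> id
    intro t
    have hc := Ring.choose_smul_choose ((n:ℝ)+1/2) (Nat.le_add_left r t)
    rw [nsmul_eq_mul, Nat.add_sub_cancel] at hc
    simp only
    rw [coeff_lin_pow, Nat.add_sub_cancel, div_pow, pow_add, inv_pow, inv_pow]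
    rw [div_eq_mul_inv (a^t)]
    generalize Ring.choose ((n:ℝ)+1/2) (t+r) = q1 at *
    generalize Ring.choose ((n:ℝ)+1/2) r = q2 at *
    generalize Ring.choose ((n:ℝ)+1/2-r) t = q3 at *
    linear_combination (Real.sqrt N * N^n * (N^t)⁻¹ * (N^r)⁻¹ * a^t) * hc
  have h3 := (hasSum_nat_add_iff (f := fun h => (Ring.choose ((n:ℝ)+1/2) h * (Real.sqrt N * N^n * (N⁻¹)^h)) * PowerSeries.coeff r (lin a^h)) r).mp h2
  rw [Finset.sum_eq_zero, add_zero] at h3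
  · exact h3
  · intro i hi
    rw [coeff_lin_pow, Nat.choose_eq_zero_of_lt (Finset.mem_range.mp hi)]; simp

lemma coeff_mul_hasSum (n : ℕ) (c : ℕ → ℝ) (Fh : ℕ → PowerSeries ℝ) (w : ℝ) (F Q : PowerSeries ℝ)
    (H : ∀ r, HasSum (fun h => c h * PowerSeries.coeff r (Fh h)) (w * PowerSeries.coeff r F)) :
    HasSum (fun h => c h * PowerSeries.coeff n (Fh h * Q)) (w * PowerSeries.coeff n (F * Q)) := by
  have : HasSum (fun h => ∑ p ∈ Finset.HasAntidiagonal.antidiagonal n, c h * PowerSeries.coeff p.1 (Fh h) * PowerSeries.coeff p.2 Q)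
     (∑ p ∈ Finset.HasAntidiagonal.antidiagonal n, w * PowerSeries.coeff p.1 F * PowerSeries.coeff p.2 Q) :=
    hasSum_sum fun p _ => (H p.1).mul_right _
  simpa only [PowerSeries.coeff_mul, Finset.mul_sum, mul_assoc] using this

lemma rem_hasSum (n i : ℕ) (N : ℝ) (hN : 4 < N) :
    HasSum (fun h => (Ring.choose ((n:ℝ)+1/2) h * (Real.sqrt N * N^n * (N⁻¹)^h)) * Lam (fun _ => n+1) (zg^(h+i)))
      (∑ j, Real.sqrt (N + nd j) * pp n i N j) := by
  unfold Lam pp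
  simp only [Finset.mul_sum]
  refine hasSum_sum fun j _ => ?_
  have h := coeff_mul_hasSum n _ _ _ _ (zg j^i * Bser (fun _ => n+1) j)
    (fun r => germ_hasSum n r N (nd j) hN (nd_bounds j).1 (nd_bounds j).2)
  have e : zg j^i * Gs n (N + nd j) * Bser (fun _ => n+1) j = Gs n (N + nd j) * (zg j^i * Bser (fun _ => n+1) j) := by ring
  rw [e]
  refine h.congr_fun ?_ |> id
  intro t
  simp only [Nat.add_sub_cancel, Pi.pow_apply, if_neg (Nat.succ_ne_zero n), zg]
  congr 2
  ring

lemma rem_bound (n i : ℕ) (hn : 1 ≤ n) (hi : i < 3) (N : ℝ) (hN : 4 < N) :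
    |∑ j, Real.sqrt (N + nd j) * pp n i N j| ≤ Real.sqrt N * (N⁻¹)^(2*n) * (1/(1-4/N)^(3*n+3)) := by
  have hN0 : 0 < N := by linarith
  set x := 4/N with hx
  have hx0 : 0 < x := by positivity
  have hx1 : x < 1 := by rw [hx, div_lt_one hN0]; linarith
  have H := rem_hasSum n i N hN
  set B : ℕ → ℝ := fun g => Real.sqrt N * N^(n+i) / 4^(3*n+2) * ((g.choose (3*n+2) : ℝ) * x^g) with hB
  have hB0 : ∀ g, 0 ≤ B g := fun g => by simp only [hB]; positivity
  have S1 := (hasSum_choose_mul_geometric_of_norm_lt_one (3*n+2) (r := x) (by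
    rw [Real.norm_eq_abs, abs_of_pos hx0]; exact hx1)).mul_left (Real.sqrt N * N^(n+i) / 4^(3*n+2) * x^(3*n+2))
  have S2 : HasSum (fun t => B (t + (3*n+2))) (Real.sqrt N * N^(n+i) / 4^(3*n+2) * x^(3*n+2) * (1/(1-x)^(3*n+2+1))) := by
    refine S1.congr_fun ?_ |> id
    intro t
    simp only [hB]; rw [pow_add]; ring
  rw [hasSum_nat_add_iff, Finset.sum_eq_zero, add_zero] at S2
  swap
  · intro g hg
    simp only [hB]
    rw [Nat.choose_eq_zero_of_lt (Finset.mem_range.mp hg)]; simp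
  have S3 : Summable (fun h => B (h+i)) := (summable_nat_add_iff i).mpr S2.summable
  have le1 : ∑' h, B (h+i) ≤ ∑' g, B g :=
    tsum_comp_le_tsum_of_inj S2.summable hB0 (add_left_injective i)
  rw [S2.tsum_eq] at le1
  have bnd : ∀ h, ‖(Ring.choose ((n:ℝ)+1/2) h * (Real.sqrt N * N^n * (N⁻¹)^h)) * Lam (fun _ => n+1) (zg^(h+i))‖ ≤ B (h+i) := by
    intro h
    obtain ⟨l0, l1⟩ := Lam_pow_bound (h+i) (3*n+2) (fun _ => n+1) (by simp; ring)
    rcases Nat.lt_or_ge (h+i) (3*n+2) with hlt | hge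
    · rw [Nat.choose_eq_zero_of_lt hlt] at l1
      have : Lam (fun _ => n+1) (zg^(h+i)) = 0 := le_antisymm (by simpa using l1) l0
      rw [this]; simpa using hB0 (h+i)
    · have hc := rc_bound2 n h (by omega)
      rw [norm_mul, norm_mul, Real.norm_eq_abs, Real.norm_eq_abs, Real.norm_eq_abs, abs_of_nonneg l0,
        abs_of_nonneg (a := Real.sqrt N * N^n * (N⁻¹)^h) (by positivity)]
      calc _ ≤ 1 * (Real.sqrt N * N^n * (N⁻¹)^h) * (((h+i).choose (3*n+2):ℝ)*4^(h+i)/4^(3*n+2)) := by gcongr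
        _ = B (h+i) := by
          simp only [hB, hx]
          rw [div_pow, pow_add N h i, pow_add N n i, inv_pow]
          field_simp
  have fin := tsum_of_norm_bounded S3.hasSum bnd
  rw [H.tsum_eq, Real.norm_eq_abs] at fin
  refine fin.trans (le1.trans ?_)
  have hsq : 0 ≤ Real.sqrt N := Real.sqrt_nonneg N
  have h1x : 0 < 1 - x := by linarith
  have e : Real.sqrt N * N^(n+i) / 4^(3*n+2) * x^(3*n+2) = Real.sqrt N * (N⁻¹)^(2*n) * (N^i/N^2) := by
    rw [hx, div_pow, inv_pow, show 3*n+2 = n + 2*n+2 by ring, pow_add N (n+2*n) 2, pow_add N n (2*n), pow_add N n i]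
    field_simp
  rw [e]
  have e2 : N^i/N^2 ≤ 1 := by
    rw [div_le_one (by positivity)]
    exact pow_le_pow_right₀ (by linarith) (by omega)
  have e3 : 0 ≤ Real.sqrt N * (N⁻¹)^(2*n) := by positivity
  refine mul_le_mul_of_nonneg_right ?_ (by positivity)
  nlinarith


lemma delta_bound (N u z e b : ℝ) (hN : 1 ≤ N) (hu : 1 ≤ u) (hz : 0 < z) (hb : 0 ≤ b)
    (he : 0 ≤ e) (heN : e ≤ N) (h : z^2 = N*(N+b)*u^2 + e) :
    |z - u * Real.sqrt N * Real.sqrt (N+b)| ≤ 1/(2*u) := by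
  have hs : Real.sqrt N * Real.sqrt (N+b) = Real.sqrt (N*(N+b)) := (Real.sqrt_mul (by linarith) _).symm
  set w := u * Real.sqrt N * Real.sqrt (N+b) with hw
  have hw2 : w^2 = N*(N+b)*u^2 := by
    rw [hw, mul_assoc, hs, mul_pow, Real.sq_sqrt (by positivity)]; ring
  have hw0 : 0 ≤ w := by positivity
  have hwN : N*u ≤ w := by
    refine abs_le_of_sq_le_sq' ?_ hw0 |>.2
    rw [hw2]; nlinarith [mul_nonneg (mul_nonneg (by linarith : 0 ≤ N) hb) (sq_nonneg u)]
  have hzN : w ≤ z := by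
    refine abs_le_of_sq_le_sq' ?_ hz.le |>.2
    linarith
  rw [abs_of_nonneg (by linarith), le_div_iff₀ (by linarith)]
  have h1 : (z-w)*(z+w) ≤ N := by nlinarith
  have h2 : (z-w)*(2*(N*u)) ≤ (z-w)*(z+w) := mul_le_mul_of_nonneg_left (by linarith) (by linarith)
  have h3 : N * ((z-w)*(2*u)) ≤ N * 1 := by nlinarith
  exact le_of_mul_le_mul_left h3 (by linarith)

lemma num1 (N : ℝ) (hN : 313632 ≤ N) (n : ℕ) (hn : 31 ≤ n) : 7272 * N^2 * (87264/N)^n < 1/2 := by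
  have hN0 : 0 < N := by linarith
  have h1 : 87264/N ≤ 87264/313632 := by gcongr
  have h2 : (87264/N)^n ≤ (87264/N)^31 :=
    pow_le_pow_of_le_one (by positivity) (h1.trans (by norm_num)) hn
  have h3 : N^2 * (87264/N)^31 = 87264^2 * (87264/N)^29 := by
    rw [show (31:ℕ) = 2 + 29 by norm_num, pow_add, div_pow 87264 N 2]; field_simp
  have h4 : (87264/N)^29 ≤ (87264/313632)^29 := by gcongr
  calc 7272 * N^2 * (87264/N)^n ≤ 7272 * N^2 * (87264/N)^31 := by gcongr
    _ = 7272 * (87264^2 * (87264/N)^29) := by rw [← h3]; ring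
    _ ≤ 7272 * (87264^2 * (87264/313632)^29) := by gcongr
    _ < 1/2 := by norm_num

lemma num2 (N : ℝ) (hN : 313632 ≤ N) (n : ℕ) (hn : 31 ≤ n) :
    12*144^n * (1.8*(3.2*(N+1))^n + 9*((N+4)/3)^n) < 1/2 * (600*N)^n := by
  have hN0 : 0 < N := by linarith
  have h1 : 144^n * (3.2*(N+1))^n ≤ 0.77^n * (600*N)^n := by
    rw [← mul_pow, ← mul_pow]
    apply pow_le_pow_left₀ (by positivity)
    linarith
  have h2 : 144^n * ((N+4)/3)^n ≤ 0.77^n * (600*N)^n := by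
    rw [← mul_pow, ← mul_pow]
    apply pow_le_pow_left₀ (by positivity)
    linarith
  have h3 : (0.77:ℝ)^n ≤ 0.77^31 := pow_le_pow_of_le_one (by norm_num) (by norm_num) hn
  have h4 : (0.77:ℝ)^31 < 1/300 := by norm_num
  have h5 : 0 < (600*N)^n := by positivity
  nlinarith

lemma Lbound (N u z T e : ℝ) (hN : 313632 ≤ N) (hu : 1 ≤ u) (hz : 0 < z) (hT : 0 < T)
    (he : 0 ≤ e) (heN : e ≤ N) (h1 : z^2 = N*(N+1)*u^2+e) (h2 : T^2 = N*(N+4)*u^2+4)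
    (n : ℕ) (hn : 31 ≤ n) (hu1 : (600*N)^n ≤ u) (hu2 : u < (600*N)^(n+1)) (i : ℕ) (hi : i < 3) :
    12*144^n * |Lam (fun _ => n+1) (zg^i * vG n N ![N*u, z, T])| < 1 := by
  have hN0 : 0 < N := by linarith
  have d1 := delta_bound N u z e 1 (by linarith) hu hz (by norm_num) he heN h1
  have d2 := delta_bound N u T 4 4 (by linarith) hu hT (by norm_num) (by norm_num) (by linarith) h2
  have p1 := pp_bound1 n i hi N hN0
  have p2 := pp_bound2 n i hi N hN0
  have R := rem_bound n i (by omega) hi N (by linarith)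
  rw [Lam_eq_pp]
  have e0 : ∑ j, (![N*u, z, T] : Fin 3 → ℝ) j * pp n i N j
     = u * Real.sqrt N * (∑ j, Real.sqrt (N + nd j) * pp n i N j)
       + (z - u * Real.sqrt N * Real.sqrt (N+1)) * pp n i N 1 + (T - u * Real.sqrt N * Real.sqrt (N+4)) * pp n i N 2 := by
    have hs := Real.mul_self_sqrt hN0.le
    rw [Fin.sum_univ_three, Fin.sum_univ_three]
    simp only [nd, Matrix.cons_val_zero, Matrix.cons_val_one, Matrix.cons_val, add_zero]
    linear_combination (-u * pp n i N 0) * hs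
  rw [e0]
  generalize (∑ j, Real.sqrt (N + nd j) * pp n i N j) = RR at *
  generalize pp n i N 1 = P1 at *
  generalize pp n i N 2 = P2 at *
  generalize z - u * Real.sqrt N * Real.sqrt (N+1) = D1 at *
  generalize T - u * Real.sqrt N * Real.sqrt (N+4) = D2 at *
  have t1 : |u * Real.sqrt N * RR| ≤ u * (N * (N⁻¹)^(2*n) * 1.01^(n+1)) := by
    rw [abs_mul, abs_of_nonneg (by positivity)]
    have hx : 1/(1-4/N)^(3*n+3) ≤ 1.01^(n+1) := by
      have a1 : 4/N ≤ 4/313632 := by gcongr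
      rw [show 3*n+3 = 3*(n+1) by ring, pow_mul, ← one_div_pow]
      have a2 : (1-4/313632:ℝ)^3 ≤ (1-4/N)^3 := by gcongr
      refine pow_le_pow_left₀ (by
        apply div_nonneg zero_le_one
        exact le_trans (by norm_num) a2) ?_ _
      calc 1/(1-4/N)^3 ≤ 1/(1-4/313632:ℝ)^3 := one_div_le_one_div_of_le (by norm_num) a2
        _ ≤ 1.01 := by norm_num
    calc u * Real.sqrt N * |RR| ≤ u * Real.sqrt N * (Real.sqrt N * (N⁻¹)^(2*n) * 1.01^(n+1)) := by
          gcongr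
          exact R.trans (by gcongr)
      _ = u * ((Real.sqrt N * Real.sqrt N) * (N⁻¹)^(2*n) * 1.01^(n+1)) := by ring
      _ = _ := by rw [Real.mul_self_sqrt hN0.le]
  have t2 : |D1 * P1| ≤ 1/(2*u) * (3.6*(3.2*(N+1))^n) := by
    rw [abs_mul]; gcongr
  have t3 : |D2 * P2| ≤ 1/(2*u) * (9*((N+4)/3)^n) := by
    rw [abs_mul]; gcongr
  have tri : |u * Real.sqrt N * RR + D1*P1 + D2*P2| ≤ |u * Real.sqrt N * RR| + |D1*P1| + |D2*P2| := abs_add_three _ _ _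
  have f1 : 12*144^n * (u * (N * (N⁻¹)^(2*n) * 1.01^(n+1))) < 1/2 := by
    refine lt_of_le_of_lt ?_ (num1 N hN n hn)
    calc 12*144^n * (u * (N * (N⁻¹)^(2*n) * 1.01^(n+1)))
        ≤ 12*144^n * ((600*N)^(n+1) * (N * (N⁻¹)^(2*n) * 1.01^(n+1))) := by gcongr
      _ = 7272 * N^2 * (144*600*1.01)^n * (N^n * (N⁻¹)^(2*n)) := by
          rw [mul_pow (144*600), mul_pow 144 600, pow_succ, pow_succ, mul_pow 600 N]; ring
      _ = _ := by
          rw [div_pow, show 2*n = n+n by ring, pow_add, inv_pow]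
          norm_num
          field_simp
  have f2 : 12*144^n * (1/(2*u) * (3.6*(3.2*(N+1))^n) + 1/(2*u) * (9*((N+4)/3)^n)) < 1/2 := by
    have q := num2 N hN n hn
    have hu0 : 0 < u := by linarith
    have e : 12*144^n * (1/(2*u) * (3.6*(3.2*(N+1))^n) + 1/(2*u) * (9*((N+4)/3)^n))
      = (12*144^n * (1.8*(3.2*(N+1))^n + 4.5*((N+4)/3)^n)) / u := by
      field_simp; ring
    rw [e, div_lt_iff₀ hu0]
    have : 0 ≤ 12*144^n * ((N+4)/3)^n := by positivity
    nlinarith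
  have hp : (0:ℝ) < 12*144^n := by positivity
  calc _ ≤ 12*144^n * (u * (N * (N⁻¹)^(2*n) * 1.01^(n+1)) + 1/(2*u) * (3.6*(3.2*(N+1))^n) + 1/(2*u) * (9*((N+4)/3)^n)) := by
        apply mul_le_mul_of_nonneg_left _ hp.le
        linarith
    _ = 12*144^n * (u * (N * (N⁻¹)^(2*n) * 1.01^(n+1))) + 12*144^n * (1/(2*u) * (3.6*(3.2*(N+1))^n) + 1/(2*u) * (9*((N+4)/3)^n)) := by ring
    _ < 1 := by linarith

theorem approx (N u z T e : ℤ) (hN : 313632 ≤ N) (hu : 1 ≤ u) (hz : 0 < z) (hT : 0 < T)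
    (he : 0 ≤ e) (heN : e ≤ N) (h1 : z^2 = N*(N+1)*u^2+e) (h2 : T^2 = N*(N+4)*u^2+4)
    (hbig : (600*N)^31 ≤ u) : False := by
  have hNr : (313632:ℝ) ≤ N := by exact_mod_cast hN
  have hur : (1:ℝ) ≤ u := by exact_mod_cast hu
  have hbigr : (600*(N:ℝ))^31 ≤ u := by exact_mod_cast hbig
  obtain ⟨n, n1, n2⟩ := exists_nat_pow_near hur (by linarith : (1:ℝ) < 600*(N:ℝ))
  have hn : 31 ≤ n := by
    have : (600*(N:ℝ))^31 < (600*(N:ℝ))^(n+1) := hbigr.trans_lt n2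
    have := (pow_lt_pow_iff_right₀ (by linarith : (1:ℝ) < 600*(N:ℝ))).mp this
    omega
  obtain ⟨i, hi, hne⟩ := nonvanish n (N:ℝ) (by linarith) ![(N:ℝ)*u, z, T] (by
    simp; constructor <;> omega)
  have hlt := Lbound N u z T e hNr hur (by exact_mod_cast hz) (by exact_mod_cast hT) (by exact_mod_cast he)
    (by exact_mod_cast heN) (by exact_mod_cast h1) (by exact_mod_cast h2) n hn n1 n2 i hi
  obtain ⟨c, hc⟩ := Lam_int n i N (by omega) ![N*u, z, T]
  have ev : (fun j => (((![N*u, z, T] : Fin 3 → ℤ) j : ℤ) : ℝ)) = ![(N:ℝ)*u, z, T] := by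
    funext j; fin_cases j <;> simp
  rw [ev] at hc
  have hp : (0:ℝ) < 12*144^n := by positivity
  have hc0 : c ≠ 0 := by
    rintro rfl
    rw [Int.cast_zero, mul_eq_zero] at hc
    rcases hc with hc | hc
    · exact hp.ne' hc
    · exact hne hc
  have : (1:ℝ) ≤ |(c:ℝ)| := by
    exact_mod_cast Int.one_le_abs hc0
  rw [← hc, abs_mul, abs_of_pos hp] at this
  linarith


lemma big_case (k : ℤ) (hk : 99 ≤ k) (y : ℤ) (hy : 0 < y) (hy2 : y^2 = 24*k^2+1) (j p : ℕ) (hp : 1 ≤ p)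
    (h : lu (16*k^2+1) j = 2*y*lu (64*k^2+1) p) : False := by
  have hlow := p_lower k (by omega) y hy hy2 j p hp h
  have hy5 : y ≤ 5*k := by nlinarith
  have hp63 : 63 ≤ p := by
    have h1 : 8*k^2 < 5*k*p := lt_of_lt_of_le hlow (by gcongr)
    have h2 : 8*k < 5*p := by
      by_contra! hc
      nlinarith
    omega
  have hV := lu_pos (64*k^2+1) (by nlinarith) p hp
  have g := lu_ge_pow (64*k^2+1) (by nlinarith) (p-1)
  rw [Nat.sub_add_cancel hp] at g
  have hN : 313632 ≤ 32*k^2 := by nlinarith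
  have z1 := lad_pell (64*k^2+1) p
  have z2 := lad_pell (16*k^2+1) j
  have w1 := lt_ge_one (64*k^2+1) (by nlinarith) p
  have w2 := lt_ge_one (16*k^2+1) (by nlinarith) j
  have huV : lu (64*k^2+1) p ≤ lu (16*k^2+1) j := by rw [h]; nlinarith
  refine approx (32*k^2) (lu (16*k^2+1) j) (y * lt (64*k^2+1) p) (2 * lt (16*k^2+1) j) (y^2) hN (by omega)
    (by positivity) (by positivity) (by positivity) (by nlinarith) ?_ ?_ ?_
  · rw [mul_pow, z1, h]; ring
  · rw [mul_pow, z2]; ring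
  · refine le_trans ?_ (g.trans huV)
    calc (600*(32*k^2))^31 ≤ ((32*k^2)*(32*k^2))^31 := by
          apply pow_le_pow_left₀ (by positivity)
          nlinarith
      _ = (32*k^2)^62 := by ring
      _ ≤ (2*(64*k^2+1)-1)^62 := by
          apply pow_le_pow_left₀ (by positivity)
          nlinarith
      _ ≤ _ := pow_le_pow_right₀ (by nlinarith) (by omega)

lemma small_k (k : ℤ) (hk : 0 < k) (hk2 : k < 99) (y : ℤ) (hy : 0 < y) (hy2 : y^2 = 24*k^2+1) :
    (k = 1 ∧ y = 5) ∨ (k = 10 ∧ y = 49) := by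
  have key : ∀ k : ℕ, k < 99 → (Nat.sqrt (24*k^2+1))^2 = 24*k^2+1 → k = 0 ∨ k = 1 ∨ k = 10 := by
    intro k hk h
    interval_cases k <;> first | omega | (exfalso; norm_num at h)
  lift k to ℕ using hk.le
  lift y to ℕ using hy.le
  have h : y^2 = 24*k^2+1 := by exact_mod_cast hy2
  have := key k (by omega) (by rw [← h, Nat.sqrt_eq'])
  rcases this with rfl | rfl | rfl
  · omega
  · left; refine ⟨rfl, ?_⟩
    push_cast at hy2
    nlinarith
  · right; refine ⟨rfl, ?_⟩
    push_cast at hy2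
    nlinarith

theorem stmt_15 (k : ℤ) (hk : 0 < k) :
    ¬ ∃ c d : ℤ, 1 < c ∧ c < d ∧
      c ≠ 8 * k ^ 2 ∧ c ≠ 8 * k ^ 2 + 1 ∧ d ≠ 8 * k ^ 2 ∧ d ≠ 8 * k ^ 2 + 1 ∧
      (∃ x : ℤ, 8 * k ^ 2 * (8 * k ^ 2 + 1) - 8 * k ^ 2 = x ^ 2) ∧
      (∃ x : ℤ, 8 * k ^ 2 * c - 8 * k ^ 2 = x ^ 2) ∧
      (∃ x : ℤ, (8 * k ^ 2 + 1) * c - 8 * k ^ 2 = x ^ 2) ∧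
      (∃ x : ℤ, 8 * k ^ 2 * d - 8 * k ^ 2 = x ^ 2) ∧
      (∃ x : ℤ, (8 * k ^ 2 + 1) * d - 8 * k ^ 2 = x ^ 2) ∧
      (∃ x : ℤ, c * d - 8 * k ^ 2 = x ^ 2) := by
  rintro ⟨c, d, hc, hcd, -, -, -, -, -, c1, c2, d1, d2, x, hx⟩
  obtain ⟨i, hi, rfl⟩ := c_form k hk c hc c1 c2
  obtain ⟨j, hj, rfl⟩ := c_form k hk d (by omega) d1 d2
  have hij : i < j := by
    by_contra! hji
    have hx1 : 1 ≤ 16*k^2+1 := by nlinarith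
    have hm : lu (16*k^2+1) j ≤ lu (16*k^2+1) i := (lu_strictMono (16*k^2+1) hx1).monotone hji
    have h0 := lu_pos (16*k^2+1) hx1 j hj
    have : 4*k*lu (16*k^2+1) j ≤ 4*k*lu (16*k^2+1) i := by gcongr
    have : (4*k*lu (16*k^2+1) j)^2 ≤ (4*k*lu (16*k^2+1) i)^2 := by gcongr
    omega
  obtain ⟨y, j', p, -, hp, hy, hy2, h⟩ := reduce_main k hk i j hi hij ⟨x, hx⟩
  rcases lt_or_ge k 99 with hlt | hge
  · rcases small_k k hk hlt y hy hy2 with ⟨rfl, rfl⟩ | ⟨rfl, rfl⟩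
    · exact case_one j' p hp h
    · exact case_ten j' p hp h
  · exact big_case k hge y hy hy2 j' p hp h
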